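/- Consider the hybrid-coupled reaction–diffusion network with adaptive coupling strength under aperiodically intermittent pinning control of node 1: let π, w¹, …, wᴺ : [−τ̄, ∞) × Ω̄ → ℝⁿ be continuous, vanish on [−τ̄, ∞) × ∂Ω, be continuously differentiable in t on (0,∞) with jointly continuous time derivative, and twice continuously differentiable in x with jointly continuous spatial derivatives, such that: π satisfies ∂π/∂t = f(π); for t in the control spans [t_i, s_i], ∂w¹/∂t = f(w¹) + Ψ(t)∑_k ξ_{1k}Γ¹w^k − Ψ(t)∑_k ξ_{1k}Γ²Δw^k + Ψ(t)σΓ¹(π − w¹) − Ψ(t)σΓ²Δ(π − w¹), and for j = 2,…,N, ∂w^j/∂t = f(w^j) + Ψ(t)∑_k ξ_{jk}Γ¹w^k − Ψ(t)∑_k ξ_{jk}Γ²Δw^k; for t in the rest spans (s_i, t_{i+1}) and all j = 1,…,N, ∂w^j/∂t = f(w^j) + ∑_k ξ_{jk}Γ¹w^k − ∑_k ξ_{jk}Γ²Δw^k. Suppose the adaptive gain Ψ satisfies Ψ(0) = 0, Ψ(t) = 0 on (s_i, t_{i+1}), Ψ(t_{i+1}) = Ψ(s_i), and on each [t_i, s_i],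 Ψ′(t) = ψ · max_{−τ̄ ≤ ς ≤ 0} ‖e(t+ς, ·)‖² with ψ > 0. If τ̄ < inf_i (s_i − t_i) and there exist 0 < θ < ω < ∞ with inf_i (s_i − t_i) = θ and sup_i (t_{i+1} − t_i) = ω, then complete synchronization is realized asymptotically: lim_{t→∞} ‖e(t,·)‖ = 0. -/

import Mathlib

open MeasureTheory Set Matrix Filter

/-- The partial derivative `∂u/∂x_r` of a scalar field on `ℝ^m`. -/
noncomputable def par {m : ℕ} (u : EuclideanSpace ℝ (Fin m) → ℝ) (r : Fin m)
    (x : EuclideanSpace ℝ (Fin m)) : ℝ :=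
  fderiv ℝ u x (EuclideanSpace.single r 1)

/-- The second partial derivative `∂²u/∂x_r²`. -/
noncomputable def par2 {m : ℕ} (u : EuclideanSpace ℝ (Fin m) → ℝ) (r : Fin m)
    (x : EuclideanSpace ℝ (Fin m)) : ℝ :=
  par (par u r) r x

/-- The Laplacian `Δu = ∑_r ∂²u/∂x_r²`. -/
noncomputable def lap {m : ℕ} (u : EuclideanSpace ℝ (Fin m) → ℝ)
    (x : EuclideanSpace ℝ (Fin m)) : ℝ :=
  ∑ r, par2 u r x

/-- The `k`-th component of the uncoupled reaction-diffusion neural-network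
drift `f(w)(t,x)`. -/
noncomputable def drift {m n : ℕ} (D : Fin n → Fin m → ℝ) (c : Fin n → ℝ)
    (A B : Matrix (Fin n) (Fin n) ℝ) (η : Fin n → ℝ)
    (g h : (Fin n → ℝ) → Fin n → ℝ) (τ : ℝ → ℝ)
    (w : ℝ → EuclideanSpace ℝ (Fin m) → Fin n → ℝ)
    (t : ℝ) (x : EuclideanSpace ℝ (Fin m)) (k : Fin n) : ℝ :=
  (∑ r, D k r * par2 (fun y => w t y k) r x) - c k * w t x k
    + (∑ q, A k q * g (w t x) q) + (∑ q, B k q * h (w (t - τ t) x) q) + η k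

/-- A zero-row-sum Metzler matrix which is irreducible has a positive left null vector. -/
theorem exists_pos_left_null {ι : Type*} [Fintype ι] [DecidableEq ι] [Nonempty ι]
    (Ξ : Matrix ι ι ℝ) (hoff : ∀ j k, j ≠ k → 0 ≤ Ξ j k) (hrow : ∀ j, ∑ k, Ξ j k = 0)
    (hirr : ∀ S : Finset ι, S.Nonempty → S ≠ Finset.univ →
      ∃ j ∈ S, ∃ k, k ∉ S ∧ 0 < Ξ j k) :
    ∃ p : ι → ℝ, (∀ j, 0 < p j) ∧ ∀ k, ∑ j, p j * Ξ j k = 0 := by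
  have hdet : Ξ.det = 0 := by
    refine Matrix.exists_mulVec_eq_zero_iff.1 ⟨fun _ => 1, ?_, ?_⟩
    · intro h
      exact one_ne_zero (congrFun h (Classical.arbitrary ι))
    · ext j
      simpa [Matrix.mulVec, dotProduct] using hrow j
  obtain ⟨v, hv0, hv⟩ := Matrix.exists_vecMul_eq_zero_iff.2 hdet
  have hv' : ∀ k, ∑ j, v j * Ξ j k = 0 := fun k => by
    simpa [Matrix.vecMul, dotProduct] using congrFun hv k
  have hnn : ∀ k, 0 ≤ ∑ j, |v j| * Ξ j k := by
    intro k
    have h1 : ∑ j ∈ Finset.univ.erase k, v j * Ξ j k = - (v k * Ξ k k) := by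
      have := Finset.add_sum_erase Finset.univ (fun j => v j * Ξ j k) (Finset.mem_univ k)
      linarith [hv' k]
    have h2 : |v k| * (-Ξ k k) ≤ ∑ j ∈ Finset.univ.erase k, |v j| * Ξ j k := by
      calc |v k| * (-Ξ k k) ≤ |v k * Ξ k k| := by
            rw [abs_mul]; exact mul_le_mul_of_nonneg_left (neg_le_abs _) (abs_nonneg _)
        _ = |∑ j ∈ Finset.univ.erase k, v j * Ξ j k| := by rw [h1, abs_neg]
        _ ≤ ∑ j ∈ Finset.univ.erase k, |v j * Ξ j k| := Finset.abs_sum_le_sum_abs _ _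
        _ = _ := Finset.sum_congr rfl fun j hj => by
            rw [abs_mul, abs_of_nonneg (hoff j k (Finset.ne_of_mem_erase hj))]
    have := Finset.add_sum_erase Finset.univ (fun j => |v j| * Ξ j k) (Finset.mem_univ k)
    linarith
  have hsum : ∑ k, ∑ j, |v j| * Ξ j k = 0 := by
    rw [Finset.sum_comm]
    simp [← Finset.mul_sum, hrow]
  have hz : ∀ k, ∑ j, |v j| * Ξ j k = 0 := fun k =>
    (Finset.sum_eq_zero_iff_of_nonneg fun k _ => hnn k).1 hsum k (Finset.mem_univ k)
  refine ⟨fun j => |v j|, ?_, hz⟩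
  by_contra! hcon
  obtain ⟨k₀, hk₀⟩ := hcon
  obtain ⟨j₀, hj₀⟩ := Function.ne_iff.1 hv0
  obtain ⟨j, hj, k, hk, hjk⟩ := hirr (Finset.univ.filter fun j => v j ≠ 0) ⟨j₀, by simpa using hj₀⟩
    (fun h => by
      have : k₀ ∈ Finset.univ.filter fun j => v j ≠ 0 := by
        rw [h]; exact Finset.mem_univ k₀
      exact (Finset.mem_filter.1 this).2 (abs_nonpos_iff.1 hk₀))
  have hvj : v j ≠ 0 := by simpa using hj
  have hvk : v k = 0 := by simpa using hk
  have hle : |v j| * Ξ j k ≤ ∑ i, |v i| * Ξ i k := by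
    refine Finset.single_le_sum (f := fun i => |v i| * Ξ i k) (fun i _ => ?_) (Finset.mem_univ j)
    by_cases hik : i = k
    · simp [hik, hvk]
    · exact mul_nonneg (abs_nonneg _) (hoff i k hik)
  rw [hz k] at hle
  exact absurd hle (not_le.2 (mul_pos (abs_pos.2 hvj) hjk))

theorem sum_mul_mul_eq_neg_half_sum_sq_sub {ι : Type*} [Fintype ι]
    (Ξ : Matrix ι ι ℝ) (hrow : ∀ j, ∑ k, Ξ j k = 0)
    (p : ι → ℝ) (hp : ∀ k, ∑ j, p j * Ξ j k = 0) (z : ι → ℝ) :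
    ∑ j, ∑ k, p j * Ξ j k * z j * z k
      = -(1 / 2) * ∑ j, ∑ k, p j * Ξ j k * (z j - z k) ^ 2 := by
  have h1 : ∑ j, ∑ k, p j * Ξ j k * z j ^ 2 = 0 := by
    refine Finset.sum_eq_zero fun j _ => ?_
    rw [← Finset.sum_mul, ← Finset.mul_sum, hrow]; simp
  have h2 : ∑ j, ∑ k, p j * Ξ j k * z k ^ 2 = 0 := by
    rw [Finset.sum_comm]
    refine Finset.sum_eq_zero fun k _ => ?_
    rw [← Finset.sum_mul, hp]; simp
  have h3 : ∑ j, ∑ k, p j * Ξ j k * (z j - z k) ^ 2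
      = ∑ j, ∑ k, p j * Ξ j k * z j ^ 2 + ∑ j, ∑ k, p j * Ξ j k * z k ^ 2
        - 2 * ∑ j, ∑ k, p j * Ξ j k * z j * z k := by
    simp only [Finset.mul_sum, ← Finset.sum_add_distrib, ← Finset.sum_sub_distrib]
    exact Finset.sum_congr rfl fun j _ => Finset.sum_congr rfl fun k _ => by ring
  rw [h3, h1, h2]; ring

theorem sum_mul_sq_sub_nonneg {ι : Type*} [Fintype ι]
    (Ξ : Matrix ι ι ℝ) (hoff : ∀ j k, j ≠ k → 0 ≤ Ξ j k)
    (p : ι → ℝ) (hp : ∀ j, 0 < p j) (z : ι → ℝ) (j k : ι) :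
    0 ≤ p j * Ξ j k * (z j - z k) ^ 2 := by
  by_cases hjk : j = k
  · simp [hjk]
  · exact mul_nonneg (mul_nonneg (hp j).le (hoff j k hjk)) (sq_nonneg _)

/-- The coupling form weighted by a left null vector is negative semidefinite. -/
theorem coupling_form_nonpos {ι : Type*} [Fintype ι]
    (Ξ : Matrix ι ι ℝ) (hoff : ∀ j k, j ≠ k → 0 ≤ Ξ j k) (hrow : ∀ j, ∑ k, Ξ j k = 0)
    (p : ι → ℝ) (hp : ∀ j, 0 < p j) (hpΞ : ∀ k, ∑ j, p j * Ξ j k = 0) (z : ι → ℝ) :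
    ∑ j, ∑ k, p j * Ξ j k * z j * z k ≤ 0 := by
  rw [sum_mul_mul_eq_neg_half_sum_sq_sub Ξ hrow p hpΞ]
  have : 0 ≤ ∑ j, ∑ k, p j * Ξ j k * (z j - z k) ^ 2 := Finset.sum_nonneg fun j _ =>
    Finset.sum_nonneg fun k _ => sum_mul_sq_sub_nonneg Ξ hoff p hp z j k
  linarith

/-- Pinning one node makes the weighted coupling form negative definite. -/
theorem exists_pinned_coupling_form_le {ι : Type*} [Fintype ι] [Nonempty ι]
    (Ξ : Matrix ι ι ℝ) (hoff : ∀ j k, j ≠ k → 0 ≤ Ξ j k) (hrow : ∀ j, ∑ k, Ξ j k = 0)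
    (hirr : ∀ S : Finset ι, S.Nonempty → S ≠ Finset.univ →
      ∃ j ∈ S, ∃ k, k ∉ S ∧ 0 < Ξ j k)
    (p : ι → ℝ) (hp : ∀ j, 0 < p j) (hpΞ : ∀ k, ∑ j, p j * Ξ j k = 0)
    (o : ι) (σ : ℝ) (hσ : 0 < σ) :
    ∃ κ > 0, ∀ z : ι → ℝ,
      (∑ j, ∑ k, p j * Ξ j k * z j * z k) - p o * σ * z o ^ 2 ≤ -κ * ∑ j, p j * z j ^ 2 := by
  classical
  set Q : (ι → ℝ) → ℝ := fun z =>
    p o * σ * z o ^ 2 - ∑ j, ∑ k, p j * Ξ j k * z j * z k with hQ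
  have hQpos : ∀ z, z ≠ 0 → 0 < Q z := by
    intro z hz
    have hsq : ∀ j k, 0 ≤ p j * Ξ j k * (z j - z k) ^ 2 := sum_mul_sq_sub_nonneg Ξ hoff p hp z
    have hQz : Q z = p o * σ * z o ^ 2 + (1 / 2) * ∑ j, ∑ k, p j * Ξ j k * (z j - z k) ^ 2 := by
      simp only [hQ, sum_mul_mul_eq_neg_half_sum_sq_sub Ξ hrow p hpΞ]; ring
    have hpσ : 0 < p o * σ := mul_pos (hp o) hσ
    have hS : 0 ≤ ∑ j, ∑ k, p j * Ξ j k * (z j - z k) ^ 2 :=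
      Finset.sum_nonneg fun j _ => Finset.sum_nonneg fun k _ => hsq j k
    by_cases hzo : z o = 0
    · obtain ⟨j₀, hj₀⟩ := Function.ne_iff.1 hz
      obtain ⟨j, hj, k, hk, hjk⟩ := hirr (Finset.univ.filter fun j => z j ≠ 0)
        ⟨j₀, by simpa using hj₀⟩ (fun h => by
          have : o ∈ Finset.univ.filter fun j => z j ≠ 0 := by
            rw [h]; exact Finset.mem_univ o
          exact (Finset.mem_filter.1 this).2 hzo)
      have hzj : z j ≠ 0 := by simpa using hj
      have hzk : z k = 0 := by simpa using hk
      have h1 : p j * Ξ j k * (z j - z k) ^ 2 ≤ ∑ j, ∑ k, p j * Ξ j k * (z j - z k) ^ 2 :=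
        (Finset.single_le_sum (f := fun k => p j * Ξ j k * (z j - z k) ^ 2)
          (fun k _ => hsq j k) (Finset.mem_univ k)).trans
        (Finset.single_le_sum (f := fun j => ∑ k, p j * Ξ j k * (z j - z k) ^ 2)
          (fun j _ => Finset.sum_nonneg fun k _ => hsq j k) (Finset.mem_univ j))
      have h2 : 0 < p j * Ξ j k * (z j - z k) ^ 2 := by
        rw [hzk, sub_zero]
        have := hp j
        positivity
      rw [hQz, hzo]
      nlinarith
    · have : 0 < p o * σ * z o ^ 2 := by positivity
      rw [hQz]; linarith
  have hcont : Continuous Q := by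
    simp only [hQ]; fun_prop
  have hsph : (Metric.sphere (0 : ι → ℝ) 1).Nonempty := NormedSpace.sphere_nonempty.2 zero_le_one
  obtain ⟨z₀, hz₀, hmin⟩ := (isCompact_sphere (0 : ι → ℝ) 1).exists_isMinOn hsph hcont.continuousOn
  have hm : 0 < Q z₀ := hQpos z₀ (fun h => by simp [h] at hz₀)
  have hP : 0 < ∑ j, p j := Finset.sum_pos (fun j _ => hp j) Finset.univ_nonempty
  refine ⟨Q z₀ / ∑ j, p j, div_pos hm hP, fun z => ?_⟩
  have hkey : Q z₀ * ‖z‖ ^ 2 ≤ Q z := by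
    by_cases hz : z = 0
    · simp [hz, hQ]
    · have hn : ‖z‖ ≠ 0 := norm_ne_zero_iff.2 hz
      have h1 : Q z₀ ≤ Q (‖z‖⁻¹ • z) := hmin (by simp [norm_smul, hn])
      have h2 : Q (‖z‖⁻¹ • z) = (‖z‖⁻¹) ^ 2 * Q z := by
        simp only [hQ, Pi.smul_apply, smul_eq_mul, mul_sub, Finset.mul_sum]
        congr 1
        · ring
        · exact Finset.sum_congr rfl fun j _ => Finset.sum_congr rfl fun k _ => by ring
      rw [h2] at h1
      calc Q z₀ * ‖z‖ ^ 2 ≤ ((‖z‖⁻¹) ^ 2 * Q z) * ‖z‖ ^ 2 :=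
            mul_le_mul_of_nonneg_right h1 (sq_nonneg _)
        _ = Q z := by field_simp
  have hle : ∑ j, p j * z j ^ 2 ≤ (∑ j, p j) * ‖z‖ ^ 2 := by
    rw [Finset.sum_mul]
    refine Finset.sum_le_sum fun j _ => mul_le_mul_of_nonneg_left ?_ (hp j).le
    rw [← sq_abs]
    exact pow_le_pow_left₀ (abs_nonneg _) (norm_le_pi_norm z j) 2
  have : Q z₀ / (∑ j, p j) * ∑ j, p j * z j ^ 2 ≤ Q z := by
    refine le_trans ?_ hkey
    rw [div_mul_eq_mul_div, div_le_iff₀ hP]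
    nlinarith
  simp only [hQ] at this ⊢
  linarith

/-- A continuous function starting positive and increasing at its first zero stays positive. -/
theorem pos_of_deriv_pos_at_first_zero {d : ℝ → ℝ} {a b : ℝ} (hc : ContinuousOn d (Icc a b))
    (ha : 0 < d a)
    (hd : ∀ t ∈ Ioc a b, (∀ s ∈ Ico a t, 0 < d s) → d t = 0 →
      ∃ d', HasDerivAt d d' t ∧ 0 < d') :
    ∀ t ∈ Icc a b, 0 < d t := by
  by_contra! hcon
  obtain ⟨t₁, ht₁, hdt₁⟩ := hcon
  set Z : Set ℝ := Icc a b ∩ d ⁻¹' Iic 0 with hZ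
  have hZc : IsCompact Z :=
    isCompact_Icc.of_isClosed_subset (hc.preimage_isClosed_of_isClosed isClosed_Icc isClosed_Iic)
      inter_subset_left
  obtain ⟨t, htZ, htmin⟩ := hZc.exists_isLeast ⟨t₁, ht₁, hdt₁⟩
  have hbefore : ∀ s ∈ Ico a t, 0 < d s := by
    intro s hs
    by_contra! h
    exact absurd (htmin ⟨⟨hs.1, hs.2.le.trans htZ.1.2⟩, h⟩) (not_le.2 hs.2)
  have hat : a < t := lt_of_le_of_ne htZ.1.1 (fun h => by
    have : d t ≤ 0 := htZ.2
    rw [← h] at this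
    linarith)
  have hleft : ∀ᶠ s in nhdsWithin t (Iio t), 0 < d s := by
    filter_upwards [Ioo_mem_nhdsLT hat] with s hs using hbefore s ⟨hs.1.le, hs.2⟩
  have hdt : d t = 0 := by
    refine le_antisymm htZ.2 ?_
    have hct : ContinuousWithinAt d (Ioo a t) t :=
      (hc t htZ.1).mono (fun s hs => ⟨hs.1.le, hs.2.le.trans htZ.1.2⟩)
    have : (nhdsWithin t (Ioo a t)).NeBot := by
      rw [nhdsWithin_Ioo_eq_nhdsLT hat]; infer_instance
    exact ge_of_tendsto hct (by
      filter_upwards [self_mem_nhdsWithin] with s hs using (hbefore s ⟨hs.1.le, hs.2⟩).le)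
  obtain ⟨d', hder, hd'⟩ := hd t ⟨hat, htZ.1.2⟩ hbefore hdt
  have hslope := (hasDerivAt_iff_tendsto_slope.1 hder).mono_left
    (nhdsWithin_mono t (fun s (hs : s ∈ Iio t) => ne_of_lt hs))
  have : d' ≤ 0 := le_of_tendsto hslope (by
    filter_upwards [hleft, self_mem_nhdsWithin] with s hs hst
    rw [slope_def_field, hdt]
    exact div_nonpos_of_nonneg_of_nonpos (by linarith) (by have : s < t := hst; linarith))
  linarith

/-- Exponential growth bound for a delay differential inequality. -/
theorem delay_growth_bound {V V' τ : ℝ → ℝ} {τb α b : ℝ} (hα : 0 ≤ α) (hb : 0 ≤ b)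
    (hτ : ∀ t, τ t ∈ Icc 0 τb)
    (hVc : ContinuousOn V (Ici (-τb)))
    (hVd : ∀ t > 0, HasDerivAt V (V' t) t)
    (hle : ∀ t > 0, V' t ≤ α * V t + b * V (t - τ t))
    {a S : ℝ} (ha : 0 ≤ a) (hS0 : 0 ≤ S) (hS : ∀ s ∈ Icc (a - τb) a, V s ≤ S) :
    ∀ t, a - τb ≤ t → ∀ T, t ≤ T → a ≤ T → V t ≤ S * Real.exp ((α + b + 1) * (T - a)) := by
  have hτb : 0 ≤ τb := (hτ 0).1.trans (hτ 0).2
  set K := α + b + 1 with hK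
  have hKpos : 0 < K := by positivity
  have hstrict : ∀ S' > S, ∀ t, a ≤ t → V t < S' * Real.exp (K * (t - a)) := by
    intro S' hS' t hat
    have hS'0 : 0 < S' := lt_of_le_of_lt hS0 hS'
    have := pos_of_deriv_pos_at_first_zero (d := fun t => S' * Real.exp (K * (t - a)) - V t)
      (a := a) (b := t) ?_ ?_ ?_ t ⟨hat, le_rfl⟩
    · linarith
    · refine ContinuousOn.sub (by fun_prop) (hVc.mono fun s hs => ?_)
      have := hs.1
      simp only [mem_Ici]; linarith
    · have := hS a ⟨by linarith, le_rfl⟩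
      simp only [sub_self, mul_zero, Real.exp_zero]
      linarith
    · intro s hs hpos hz
      have hs0 : 0 < s := lt_of_le_of_lt ha hs.1
      refine ⟨S' * (Real.exp (K * (s - a)) * K) - V' s, ?_, ?_⟩
      · refine HasDerivAt.sub (HasDerivAt.const_mul _ ?_) (hVd s hs0)
        have h1 : HasDerivAt (fun t => K * (t - a)) K s := by
          simpa using ((hasDerivAt_id s).sub_const a).const_mul K
        exact h1.exp
      · set E := S' * Real.exp (K * (s - a)) with hE
        have hEpos : 0 < E := by positivity
        have hVs : V s = E := by linarith
        have hdel : V (s - τ s) ≤ E := by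
          have hτs := hτ s
          by_cases hsa : s - τ s ≤ a
          · have h1 := hS (s - τ s) ⟨by linarith [hτs.2, hs.1], hsa⟩
            have h2 : 1 ≤ Real.exp (K * (s - a)) :=
              Real.one_le_exp (mul_nonneg hKpos.le (by linarith [hs.1]))
            nlinarith
          · rcases eq_or_lt_of_le hτs.1 with h0 | h0
            · rw [← h0, sub_zero, hVs]
            · have h1 := hpos (s - τ s) ⟨by linarith, by linarith⟩
              have h2 : Real.exp (K * (s - τ s - a)) ≤ Real.exp (K * (s - a)) :=
                Real.exp_le_exp.2 (mul_le_mul_of_nonneg_left (by linarith) hKpos.le)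
              have h3 := mul_le_mul_of_nonneg_left h2 hS'0.le
              linarith
        have h1 := hle s hs0
        rw [hVs] at h1
        have h2 : S' * (Real.exp (K * (s - a)) * K) = E * K := by rw [hE]; ring
        rw [h2, hK]
        nlinarith [mul_le_mul_of_nonneg_left hdel hb]
  have hcl : ∀ t, a ≤ t → V t ≤ S * Real.exp (K * (t - a)) := by
    intro t hat
    have htend : Tendsto (fun S' => S' * Real.exp (K * (t - a))) (nhdsWithin S (Ioi S))
        (nhds (S * Real.exp (K * (t - a)))) :=
      ((continuous_id.mul continuous_const).tendsto S).mono_left nhdsWithin_le_nhds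
    exact ge_of_tendsto htend (by
      filter_upwards [self_mem_nhdsWithin] with S' hS' using (hstrict S' hS' t hat).le)
  intro t hta T htT haT
  have hone : 1 ≤ Real.exp (K * (T - a)) :=
    Real.one_le_exp (mul_nonneg hKpos.le (by linarith))
  by_cases h : t ≤ a
  · have := hS t ⟨hta, h⟩
    nlinarith
  · refine (hcl t (not_le.1 h).le).trans (mul_le_mul_of_nonneg_left ?_ hS0)
    exact Real.exp_le_exp.2 (mul_le_mul_of_nonneg_left (by linarith) hKpos.le)

/-- On a span with strong damping `μ` the delay inequality forces decay up to a factor `ε`. -/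
theorem delay_decay_bound {V V' τ : ℝ → ℝ} {τb μ b lam ε : ℝ} (hb : 0 ≤ b) (hε : 0 < ε)
    (hlam : 0 ≤ lam) (hμ : lam ≤ μ) (hμε : b * (1 + ε) < μ * ε)
    (hτ : ∀ t, τ t ∈ Icc 0 τb)
    (hVc : ContinuousOn V (Ici (-τb)))
    (hVd : ∀ t > 0, HasDerivAt V (V' t) t)
    {a c S : ℝ} (ha : 0 ≤ a)
    (hle : ∀ t ∈ Icc a c, 0 < t → V' t ≤ -μ * V t + b * V (t - τ t))
    (hS0 : 0 ≤ S) (hS : ∀ s ∈ Icc (a - τb) a, V s ≤ S) :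
    ∀ t ∈ Icc a c, V t ≤ S * (Real.exp (-lam * (t - a)) + ε) := by
  have hτb : 0 ≤ τb := (hτ 0).1.trans (hτ 0).2
  have hstrict : ∀ S' > S, ∀ t ∈ Icc a c, V t < S' * (Real.exp (-lam * (t - a)) + ε) := by
    intro S' hS'
    have hS'0 : 0 < S' := lt_of_le_of_lt hS0 hS'
    have := pos_of_deriv_pos_at_first_zero
      (d := fun t => S' * (Real.exp (-lam * (t - a)) + ε) - V t)
      (a := a) (b := c) ?_ ?_ ?_
    · exact fun t ht => by linarith [this t ht]
    · refine ContinuousOn.sub (by fun_prop) (hVc.mono fun s hs => ?_)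
      have := hs.1
      simp only [mem_Ici]; linarith
    · have := hS a ⟨by linarith, le_rfl⟩
      simp only [sub_self, mul_zero, Real.exp_zero]
      nlinarith
    · intro s hs hpos hz
      have hs0 : 0 < s := lt_of_le_of_lt ha hs.1
      refine ⟨S' * (Real.exp (-lam * (s - a)) * (-lam)) - V' s, ?_, ?_⟩
      · refine HasDerivAt.sub (HasDerivAt.const_mul _ ?_) (hVd s hs0)
        have h1 : HasDerivAt (fun t => -lam * (t - a)) (-lam) s := by
          simpa using ((hasDerivAt_id s).sub_const a).const_mul (-lam)
        exact h1.exp.add_const ε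
      · set E := Real.exp (-lam * (s - a)) with hE
        have hEpos : 0 < E := by positivity
        have hbound : ∀ r, a ≤ r → S' * (Real.exp (-lam * (r - a)) + ε) ≤ S' * (1 + ε) := by
          intro r hr
          have : Real.exp (-lam * (r - a)) ≤ 1 :=
            Real.exp_le_one_iff.2 (by nlinarith)
          exact mul_le_mul_of_nonneg_left (by linarith) hS'0.le
        have hVs : V s = S' * (E + ε) := by linarith
        have hdel : V (s - τ s) ≤ S' * (1 + ε) := by
          have hτs := hτ s
          by_cases hsa : s - τ s ≤ a
          · have h1 := hS (s - τ s) ⟨by linarith [hτs.2, hs.1], hsa⟩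
            nlinarith
          · rcases eq_or_lt_of_le hτs.1 with h0 | h0
            · rw [← h0, sub_zero, hVs]
              exact hbound s hs.1.le
            · have h1 := hpos (s - τ s) ⟨by linarith, by linarith⟩
              have h2 := hbound (s - τ s) (by linarith)
              linarith
        have h1 := hle s ⟨hs.1.le, hs.2⟩ hs0
        rw [hVs] at h1
        have h4 := mul_le_mul_of_nonneg_left hdel hb
        have h5 : lam * (S' * E) ≤ μ * (S' * E) :=
          mul_le_mul_of_nonneg_right hμ (mul_pos hS'0 hEpos).le
        have h6 := mul_lt_mul_of_pos_left hμε hS'0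
        nlinarith
  intro t ht
  have htend : Tendsto (fun S' => S' * (Real.exp (-lam * (t - a)) + ε)) (nhdsWithin S (Ioi S))
      (nhds (S * (Real.exp (-lam * (t - a)) + ε))) :=
    ((continuous_id.mul continuous_const).tendsto S).mono_left nhdsWithin_le_nhds
  exact ge_of_tendsto htend (by
    filter_upwards [self_mem_nhdsWithin] with S' hS' using (hstrict S' hS' t ht).le)

theorem exists_mem_Ico_of_tendsto_atTop {ts : ℕ → ℝ} (hlim : Tendsto ts atTop atTop)
    (i₀ : ℕ) {t : ℝ} (ht : ts i₀ ≤ t) : ∃ i ≥ i₀, t ∈ Ico (ts i) (ts (i + 1)) := by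
  classical
  have hex : ∃ j, t < ts (i₀ + j) := by
    obtain ⟨M, hM⟩ := (hlim.eventually_gt_atTop t).exists_forall_of_atTop
    exact ⟨M, hM _ (by omega)⟩
  have hspec := Nat.find_spec hex
  have hmin := fun j => Nat.find_min (m := j) hex
  rcases h : Nat.find hex with _ | j
  · rw [h, add_zero] at hspec; linarith
  · rw [h] at hspec hmin
    exact ⟨i₀ + j, by omega, not_lt.1 (hmin j (by omega)), hspec⟩

/-- If the history suprema at the switching times tend to zero and growth between switching
times is controlled, then the function tends to zero. -/
theorem tendsto_zero_of_history_bounds {V : ℝ → ℝ} {ts : ℕ → ℝ} {C : ℝ} {S : ℕ → ℝ}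
    (hlim : Tendsto ts atTop atTop) (hV0 : ∀ t, 0 ≤ V t)
    (hS : Tendsto S atTop (nhds 0))
    (hbound : ∀ i, ∀ t ∈ Icc (ts i) (ts (i + 1)), V t ≤ S i * C) :
    Tendsto V atTop (nhds 0) := by
  have hSC : Tendsto (fun i => S i * C) atTop (nhds 0) := by simpa using hS.mul_const C
  refine tendsto_order.2 ⟨fun a ha => Eventually.of_forall fun t => ha.trans_le (hV0 t),
    fun ε hε => ?_⟩
  obtain ⟨i₀, hi₀⟩ := (hSC.eventually_lt_const hε).exists_forall_of_atTop
  filter_upwards [eventually_ge_atTop (ts i₀)] with t ht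
  obtain ⟨i, hi, hti⟩ := exists_mem_Ico_of_tendsto_atTop hlim i₀ ht
  exact (hbound i t (Ico_subset_Icc_self hti)).trans_lt (hi₀ i hi)

/-- Asymptotic decay for a delay differential inequality with an intermittent adaptive gain that
grows as long as the solution does not vanish. -/
theorem tendsto_zero_of_adaptive_delay_inequality {V V' E τ Ψ : ℝ → ℝ} {ts ss : ℕ → ℝ}
    {τb α b β ψ θ ω P : ℝ} (hα : 0 ≤ α) (hb : 0 ≤ b) (hβ : 0 < β) (hψ : 0 < ψ) (hP : 0 ≤ P)
    (hτ : ∀ t, τ t ∈ Icc 0 τb) (hτθ : τb < θ) (hts0 : ts 0 = 0)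
    (hcs : ∀ i, θ ≤ ss i - ts i) (hrs : ∀ i, ss i < ts (i + 1)) (hω : ∀ i, ts (i + 1) - ts i ≤ ω)
    (hlim : Tendsto ts atTop atTop)
    (hV0 : ∀ t, 0 ≤ V t) (hVc : ContinuousOn V (Ici (-τb)))
    (hVd : ∀ t > 0, HasDerivAt V (V' t) t)
    (hle : ∀ t > 0, V' t ≤ α * V t + b * V (t - τ t))
    (hctrl : ∀ i, ∀ t ∈ Icc (ts i) (ss i), 0 < t →
      V' t ≤ (α - β * Ψ t) * V t + b * V (t - τ t))
    (hE0 : ∀ t, 0 ≤ E t) (hEc : ContinuousOn E (Ici (-τb)))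
    (hVE : ∀ t ∈ Ici (-τb), V t ≤ P * E t)
    (hΨjump : ∀ i, Ψ (ts (i + 1)) = Ψ (ss i))
    (hΨd : ∀ i, ∀ t ∈ Icc (ts i) (ss i),
      HasDerivWithinAt Ψ (ψ * sSup ((fun ς => E (t + ς)) '' Icc (-τb) 0)) (Icc (ts i) (ss i)) t) :
    Tendsto V atTop (nhds 0) := by
  have hτb : 0 ≤ τb := (hτ 0).1.trans (hτ 0).2
  have hts_mono : Monotone ts := monotone_nat_of_le_succ fun i => by
    linarith [hcs i, hrs i]
  have hts_nn : ∀ i, 0 ≤ ts i := fun i => hts0 ▸ hts_mono (Nat.zero_le i)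
  set K := α + b + 1 with hK
  have hKpos : 0 < K := by positivity
  have hgrow : ∀ {a S : ℝ}, 0 ≤ a → 0 ≤ S → (∀ s ∈ Icc (a - τb) a, V s ≤ S) →
      ∀ T, a ≤ T → T ≤ a + ω → ∀ t ∈ Icc (a - τb) T, V t ≤ S * Real.exp (K * ω) := by
    intro a S ha hS0 hS T haT hTω t ht
    refine (delay_growth_bound hα hb hτ hVc hVd hle ha hS0 hS t ht.1 T ht.2 haT).trans ?_
    exact mul_le_mul_of_nonneg_left (Real.exp_le_exp.2
      (mul_le_mul_of_nonneg_left (by linarith) hKpos.le)) hS0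
  have hΨnn : ∀ t, 0 ≤ ψ * sSup ((fun ς => E (t + ς)) '' Icc (-τb) 0) := fun t =>
    mul_nonneg hψ.le (Real.sSup_nonneg (by rintro _ ⟨ς, _, rfl⟩; exact hE0 _))
  have hΨmono : ∀ i, MonotoneOn Ψ (Icc (ts i) (ss i)) := fun i =>
    monotoneOn_of_hasDerivWithinAt_nonneg (convex_Icc _ _)
      (fun t ht => (hΨd i t ht).continuousWithinAt)
      (fun t ht => (hΨd i t (interior_subset ht)).mono interior_subset) (fun t _ => hΨnn t)
  have hts_le : ∀ i, ts i ≤ ss i := fun i => by linarith [hcs i]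
  have hgain_mono : Monotone fun i => Ψ (ss i) := monotone_nat_of_le_succ fun i => by
    rw [← hΨjump i]
    exact hΨmono (i + 1) ⟨le_rfl, hts_le _⟩ ⟨hts_le _, le_rfl⟩ (hts_le _)
  -- it suffices to bound the history at each late switching time
  suffices ∃ (i₀ : ℕ) (S : ℕ → ℝ), (∀ i, 0 ≤ S i) ∧ Tendsto S atTop (nhds 0) ∧
      ∀ i, ∀ s ∈ Icc (ts (i + i₀) - τb) (ts (i + i₀)), V s ≤ S i by
    obtain ⟨i₀, S, hS0, hSlim, hS⟩ := this
    refine tendsto_zero_of_history_bounds (ts := fun i => ts (i + i₀)) (C := Real.exp (K * ω))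
      (hlim.comp (tendsto_add_atTop_nat i₀)) hV0 hSlim fun i t ht => ?_
    have h1 : ts (i + i₀) ≤ ts (i + 1 + i₀) := hts_mono (by omega)
    have h2 : ts (i + 1 + i₀) ≤ ts (i + i₀) + ω := by
      have := hω (i + i₀)
      rw [show i + i₀ + 1 = i + 1 + i₀ by omega] at this
      linarith
    exact hgrow (hts_nn _) (hS0 i) (hS i) _ h1 h2 t ⟨by linarith [ht.1], ht.2⟩
  by_cases hbdd : BddAbove (range fun i => Ψ (ss i))
  · -- bounded gain: its increments over the control spans tend to zero
    have hconv := tendsto_atTop_ciSup hgain_mono hbdd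
    set δ : ℕ → ℝ := fun i => (Ψ (ss (i + 1)) - Ψ (ss i)) with hδ
    have hδlim : Tendsto δ atTop (nhds 0) := by
      simpa using (hconv.comp (tendsto_add_atTop_nat 1)).sub hconv
    have hδ0 : ∀ i, 0 ≤ δ i := fun i => sub_nonneg.2 (hgain_mono (Nat.le_succ i))
    have hθ : 0 < θ := hτb.trans_lt hτθ
    refine ⟨2, fun i => P * (δ i / (ψ * θ)) * Real.exp (K * ω), fun i => ?_, ?_, ?_⟩
    · have := hδ0 i
      positivity
    · have := ((hδlim.div_const (ψ * θ)).const_mul P).mul_const (Real.exp (K * ω))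
      simpa using this
    · intro i
      have hlt : ts (i + 1) < ss (i + 1) := by linarith [hcs (i + 1)]
      obtain ⟨ξ, hξ, hslope⟩ := exists_hasDerivAt_eq_slope Ψ
        (fun t => ψ * sSup ((fun ς => E (t + ς)) '' Icc (-τb) 0)) hlt
        (fun t ht => (hΨd (i + 1) t ht).continuousWithinAt)
        (fun t ht => (hΨd (i + 1) t (Ioo_subset_Icc_self ht)).hasDerivAt (Icc_mem_nhds ht.1 ht.2))
      have hξ0 : 0 ≤ ξ := (hts_nn (i + 1)).trans hξ.1.le
      rw [hΨjump i] at hslope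
      have hsup : sSup ((fun ς => E (ξ + ς)) '' Icc (-τb) 0) ≤ δ i / (ψ * θ) := by
        have h1 : ψ * sSup ((fun ς => E (ξ + ς)) '' Icc (-τb) 0) ≤ δ i / θ := by
          rw [hslope]
          exact div_le_div_of_nonneg_left (hδ0 i) hθ (hcs (i + 1))
        rw [le_div_iff₀ (mul_pos hψ hθ)]
        rw [le_div_iff₀ hθ] at h1
        linarith
      have hEbdd : BddAbove ((fun ς => E (ξ + ς)) '' Icc (-τb) 0) :=
        isCompact_Icc.bddAbove_image (hEc.comp (by fun_prop) fun ς hς => by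
          have := hς.1
          simp only [mem_Ici]; linarith)
      have hhist : ∀ s ∈ Icc (ξ - τb) ξ, V s ≤ P * (δ i / (ψ * θ)) := by
        intro s hs
        refine (hVE s (mem_Ici.2 (by linarith [hs.1]))).trans
          (mul_le_mul_of_nonneg_left (le_trans ?_ hsup) hP)
        refine le_csSup hEbdd ⟨s - ξ, ⟨by linarith [hs.1], by linarith [hs.2]⟩, ?_⟩
        simp
      have hδi := hδ0 i
      have hup : ts (i + 2) ≤ ξ + ω := by
        have h1 : ts (i + 2) - ts (i + 1) ≤ ω := hω (i + 1)
        linarith [hξ.1]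
      have hξs : ξ ≤ ts (i + 2) := by
        have h1 : ss (i + 1) < ts (i + 2) := hrs (i + 1)
        linarith [hξ.2]
      intro s hs
      exact hgrow hξ0 (by positivity) hhist (ts (i + 2)) hξs hup s ⟨by linarith [hs.1], hs.2⟩
  · -- unbounded gain: eventually every control span contracts
    obtain ⟨ε, hε, hεK⟩ : ∃ ε > 0, 2 * ε * Real.exp (K * ω) = 1 / 2 :=
      ⟨1 / (4 * Real.exp (K * ω)), by positivity, by field_simp; norm_num⟩
    obtain ⟨lam, hlam, hlamε⟩ : ∃ lam ≥ 0, Real.exp (-lam * (θ - τb)) ≤ ε := by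
      have hlt : Tendsto (fun lam => Real.exp (-lam * (θ - τb))) atTop (nhds 0) := by
        refine Real.tendsto_exp_atBot.comp ?_
        exact tendsto_neg_atTop_atBot.atBot_mul_const (sub_pos.2 hτθ)
      obtain ⟨lam, h1, h2⟩ := ((hlt.eventually_le_const hε).and (eventually_ge_atTop 0)).exists
      exact ⟨lam, h2, h1⟩
    set μ := lam + b * (1 + ε) / ε + 1 with hμ
    have hμlam : lam ≤ μ := by
      have : 0 ≤ b * (1 + ε) / ε := by positivity
      linarith
    have hμε : b * (1 + ε) < μ * ε := by
      have : μ * ε = lam * ε + b * (1 + ε) + ε := by rw [hμ]; field_simp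
      rw [this]
      nlinarith
    obtain ⟨i₁, hi₁⟩ : ∃ i₁, (α + μ) / β ≤ Ψ (ss i₁) := by
      by_contra! hcon
      exact hbdd ⟨(α + μ) / β, by rintro _ ⟨i, rfl⟩; exact (hcon i).le⟩
    have hstrong : ∀ i > i₁, ∀ t ∈ Icc (ts i) (ss i), 0 < t →
        V' t ≤ -μ * V t + b * V (t - τ t) := by
      intro i hi t ht ht0
      obtain ⟨k, rfl⟩ : ∃ k, i = k + 1 := ⟨i - 1, by omega⟩
      have h1 : Ψ (ss i₁) ≤ Ψ t := by
        refine (hgain_mono (show i₁ ≤ k by omega)).trans ?_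
        simp only [← hΨjump k]
        exact hΨmono (k + 1) ⟨le_rfl, hts_le _⟩ ht ht.1
      have h2 : α + μ ≤ β * Ψ t := by
        rw [div_le_iff₀ hβ] at hi₁
        nlinarith
      have h3 := hctrl (k + 1) t ht ht0
      nlinarith [hV0 t]
    have hcontract : ∀ i > i₁, ∀ S, 0 ≤ S → (∀ s ∈ Icc (ts i - τb) (ts i), V s ≤ S) →
        ∀ s ∈ Icc (ts (i + 1) - τb) (ts (i + 1)), V s ≤ S / 2 := by
      intro i hi S hS0 hS
      have hdec := delay_decay_bound hb hε hlam hμlam hμε hτ hVc hVd (hts_nn i) (hstrong i hi)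
        hS0 hS
      have hend : ∀ s ∈ Icc (ss i - τb) (ss i), V s ≤ S * (2 * ε) := by
        intro s hs
        have hθs : θ - τb ≤ s - ts i := by linarith [hs.1, hcs i]
        refine (hdec s ⟨by linarith, hs.2⟩).trans (mul_le_mul_of_nonneg_left ?_ hS0)
        have : Real.exp (-lam * (s - ts i)) ≤ Real.exp (-lam * (θ - τb)) :=
          Real.exp_le_exp.2 (by nlinarith)
        linarith
      intro s hs
      have := hgrow ((hts_nn i).trans (hts_le i)) (by positivity) hend (ts (i + 1)) (hrs i).le
        (by linarith [hω i, hts_le i]) s ⟨by linarith [hs.1, hrs i], hs.2⟩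
      calc V s ≤ S * (2 * ε) * Real.exp (K * ω) := this
        _ = S * (2 * ε * Real.exp (K * ω)) := by ring
        _ = S / 2 := by rw [hεK]; ring
    obtain ⟨S₀, hS₀⟩ := isCompact_Icc.bddAbove_image (hVc.mono
      (fun s hs => by
        have := hs.1
        have := hts_nn (i₁ + 1)
        simp only [mem_Ici]; linarith : Icc (ts (i₁ + 1) - τb) (ts (i₁ + 1)) ⊆ Ici (-τb)))
    have hS₀' : ∀ s ∈ Icc (ts (i₁ + 1) - τb) (ts (i₁ + 1)), V s ≤ S₀ := fun s hs =>
      hS₀ ⟨s, hs, rfl⟩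
    have hS₀nn : 0 ≤ S₀ := (hV0 _).trans (hS₀' (ts (i₁ + 1)) ⟨by linarith, le_rfl⟩)
    refine ⟨i₁ + 1, fun i => S₀ * (1 / 2) ^ i, fun i => by positivity, ?_, ?_⟩
    · simpa using (tendsto_pow_atTop_nhds_zero_of_lt_one (r := (1 / 2 : ℝ)) (by norm_num)
        (by norm_num)).const_mul S₀
    · intro i
      induction i with
      | zero => simpa using hS₀'
      | succ i ih =>
        have := hcontract (i + (i₁ + 1)) (by omega) _ (by positivity) ih
        rw [show i + 1 + (i₁ + 1) = i + (i₁ + 1) + 1 by omega]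
        intro s hs
        refine (this s hs).trans (le_of_eq ?_)
        simp only [pow_succ]; ring

theorem closure_euclidean_box {m : ℕ} (l : Fin m → ℝ) (hl : ∀ r, 0 < l r) :
    closure {x : EuclideanSpace ℝ (Fin m) | ∀ r, |x r| < l r} = {x | ∀ r, |x r| ≤ l r} := by
  have h1 : {x : EuclideanSpace ℝ (Fin m) | ∀ r, |x r| < l r}
      = (PiLp.continuousLinearEquiv 2 ℝ (fun _ : Fin m => ℝ)).toHomeomorph ⁻¹'
        (Set.pi univ fun r => Ioo (-l r) (l r)) := by
    ext x; simp [abs_lt]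
  rw [h1, ← Homeomorph.preimage_closure, closure_pi_set]
  have h2 : ∀ r, closure (Ioo (-l r) (l r)) = Icc (-l r) (l r) := fun r =>
    closure_Ioo (by linarith [hl r])
  ext x
  simp [h2, abs_le, Pi.le_def, forall_and]

theorem isOpen_euclidean_box {m : ℕ} (l : Fin m → ℝ) :
    IsOpen {x : EuclideanSpace ℝ (Fin m) | ∀ r, |x r| < l r} := by
  rw [ofPred_forall]
  exact isOpen_iInter_of_finite fun r => isOpen_lt (by fun_prop) continuous_const

theorem isCompact_closure_euclidean_box {m : ℕ} (l : Fin m → ℝ) (hl : ∀ r, 0 < l r) :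
    IsCompact (closure {x : EuclideanSpace ℝ (Fin m) | ∀ r, |x r| < l r}) := by
  have h1 : {x : EuclideanSpace ℝ (Fin m) | ∀ r, |x r| ≤ l r}
      = (PiLp.continuousLinearEquiv 2 ℝ (fun _ : Fin m => ℝ)).toHomeomorph ⁻¹'
        (Icc (fun r => -l r) l) := by
    ext x; simp [abs_le, Pi.le_def, forall_and]
  rw [closure_euclidean_box l hl, h1, Homeomorph.isCompact_preimage]
  exact isCompact_Icc

/-- The integral over a box of a partial derivative of a function vanishing on the boundary
is zero. -/
theorem setIntegral_partial_eq_zero {m : ℕ} (l : Fin (m + 1) → ℝ) (hl : ∀ r, 0 < l r)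
    {Ω : Set (EuclideanSpace ℝ (Fin (m + 1)))}
    (hΩ : Ω = {x : EuclideanSpace ℝ (Fin (m + 1)) | ∀ r, |x r| < l r})
    (r : Fin (m + 1)) {F G : EuclideanSpace ℝ (Fin (m + 1)) → ℝ}
    (hF : ContinuousOn F (closure Ω)) (hG : ContinuousOn G (closure Ω))
    (hF0 : ∀ x ∈ frontier Ω, F x = 0)
    (hd : ∀ x ∈ Ω, DifferentiableAt ℝ F x ∧ fderiv ℝ F x (EuclideanSpace.single r 1) = G x) :
    ∫ x in Ω, G x = 0 := by
  classical
  set eL := (PiLp.continuousLinearEquiv 2 ℝ (fun _ : Fin (m + 1) => ℝ)).symm with heL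
  have hopen : IsOpen Ω := hΩ ▸ isOpen_euclidean_box l
  have hclos : closure Ω = {x | ∀ r, |x r| ≤ l r} := hΩ ▸ closure_euclidean_box l hl
  have hmem : ∀ y : Fin (m + 1) → ℝ, y ∈ Icc (-l) l → eL y ∈ closure Ω := by
    intro y hy
    rw [hclos]
    exact fun r => abs_le.2 ⟨hy.1 r, hy.2 r⟩
  have hfront : ∀ y ∈ Icc (-l) l, ∀ i, (y i = l i ∨ y i = -l i) → F (eL y) = 0 := by
    intro y hy i hi
    refine hF0 _ ?_
    rw [hopen.frontier_eq]
    refine ⟨hmem y hy, fun h => ?_⟩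
    rw [hΩ] at h
    have h1 : |y i| < l i := h i
    rcases hi with hi | hi
    · rw [hi] at h1; exact absurd h1 (not_lt.2 (le_abs_self _))
    · rw [hi, abs_neg] at h1; exact absurd h1 (not_lt.2 (le_abs_self _))
  have hpre : eL ⁻¹' Ω = Set.pi univ fun i => Ioo (-l i) (l i) := by
    ext y; simp [hΩ, heL, abs_lt]
  have hint : ∫ x in Ω, G x = ∫ y in Icc (-l) l, G (eL y) := by
    have hmp : MeasurePreserving (fun y => eL y) volume volume :=
      PiLp.volume_preserving_toLp (Fin (m + 1))
    rw [← hmp.setIntegral_preimage_emb eL.toHomeomorph.measurableEmbedding, hpre]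
    exact setIntegral_congr_set Measure.univ_pi_Ioo_ae_eq_Icc
  have hGc : ContinuousOn (fun y => G (eL y)) (Icc (-l) l) :=
    hG.comp eL.continuous.continuousOn hmem
  have hFc : ContinuousOn (fun y => F (eL y)) (Icc (-l) l) :=
    hF.comp eL.continuous.continuousOn hmem
  have hll : -l ≤ l := fun i => by have := hl i; simp only [Pi.neg_apply]; linarith
  set f : Fin (m + 1) → (Fin (m + 1) → ℝ) → ℝ := fun i y => if i = r then F (eL y) else 0 with hf
  set f' : Fin (m + 1) → (Fin (m + 1) → ℝ) → (Fin (m + 1) → ℝ) →L[ℝ] ℝ := fun i y =>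
    if i = r then
      if eL y ∈ Ω then (fderiv ℝ F (eL y)).comp (eL : (Fin (m + 1) → ℝ) →L[ℝ] _)
      else G (eL y) • ContinuousLinearMap.proj r
    else 0 with hf'
  have hsum : ∀ y, ∑ i, f' i y (Pi.single i 1) = G (eL y) := by
    intro y
    rw [Finset.sum_eq_single r (fun i _ hi => by simp [hf', hi]) (by simp)]
    by_cases h : eL y ∈ Ω
    · simp only [hf', if_true, h]
      exact (hd _ h).2
    · simp [hf', h]
  have hdiv := integral_divergence_of_hasFDerivAt_off_countable' (-l) l hll f f' ∅ countable_empty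
    (fun i => by
      by_cases hi : i = r
      · simpa [hf, hi] using hFc
      · simpa [hf, hi] using continuousOn_const)
    (fun y hy i => by
      have hy' : eL y ∈ Ω := by
        have : y ∈ eL ⁻¹' Ω := by rw [hpre]; exact hy.1
        exact this
      by_cases hi : i = r
      · simp only [hf, hf', hi, if_true, hy']
        exact (hd _ hy').1.hasFDerivAt.comp y eL.hasFDerivAt
      · simp only [hf, hf', hi, if_false]
        exact hasFDerivAt_const _ _)
    (by simp only [hsum]; exact hGc.integrableOn_compact isCompact_Icc)
  simp only [hsum] at hdiv
  rw [hint, hdiv]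
  refine Finset.sum_eq_zero fun i _ => ?_
  have hface : ∀ v, (v = l i ∨ v = -l i) →
      ∫ y in Icc ((-l) ∘ i.succAbove) (l ∘ i.succAbove), f i (i.insertNth v y) = 0 := by
    intro v hv
    refine setIntegral_eq_zero_of_forall_eq_zero fun y hy => ?_
    simp only [hf]
    split_ifs with hir
    · refine hfront _ ?_ i (by simpa using hv)
      have hvI : v ∈ Icc ((-l) i) (l i) := by
        have := hl i
        rcases hv with rfl | rfl <;> simp only [Pi.neg_apply, mem_Icc] <;> constructor <;> linarith
      exact Fin.insertNth_mem_Icc.2 ⟨hvI, hy⟩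
    · rfl
  rw [hface (l i) (Or.inl rfl), hface ((-l) i) (Or.inr rfl), sub_zero]

/-- Integration by parts over a box against a function vanishing on the boundary. -/
theorem setIntegral_mul_partial_eq_neg {m : ℕ} (l : Fin (m + 1) → ℝ) (hl : ∀ r, 0 < l r)
    {Ω : Set (EuclideanSpace ℝ (Fin (m + 1)))}
    (hΩ : Ω = {x : EuclideanSpace ℝ (Fin (m + 1)) | ∀ r, |x r| < l r})
    (r : Fin (m + 1)) {u u' v v' : EuclideanSpace ℝ (Fin (m + 1)) → ℝ}
    (hu : ContinuousOn u (closure Ω)) (hu' : ContinuousOn u' (closure Ω))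
    (hv : ContinuousOn v (closure Ω)) (hv' : ContinuousOn v' (closure Ω))
    (hu0 : ∀ x ∈ frontier Ω, u x = 0)
    (hud : ∀ x ∈ Ω, DifferentiableAt ℝ u x ∧ fderiv ℝ u x (EuclideanSpace.single r 1) = u' x)
    (hvd : ∀ x ∈ Ω, DifferentiableAt ℝ v x ∧ fderiv ℝ v x (EuclideanSpace.single r 1) = v' x) :
    ∫ x in Ω, u x * v' x = -∫ x in Ω, u' x * v x := by
  have hK : IsCompact (closure Ω) := hΩ ▸ isCompact_closure_euclidean_box l hl
  have h := setIntegral_partial_eq_zero l hl hΩ r (F := fun x => u x * v x)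
    (G := fun x => u x * v' x + u' x * v x) (hu.mul hv) ((hu.mul hv').add (hu'.mul hv))
    (fun x hx => by simp [hu0 x hx]) (fun x hx => by
      refine ⟨(hud x hx).1.mul (hvd x hx).1, ?_⟩
      rw [fderiv_fun_mul (hud x hx).1 (hvd x hx).1]
      simp [(hud x hx).2, (hvd x hx).2, mul_comm])
  rw [integral_add] at h
  · linarith
  · exact ((hu.mul hv').integrableOn_compact hK).mono_set subset_closure
  · exact ((hu'.mul hv).integrableOn_compact hK).mono_set subset_closure

/-- A positive semidefinite combination of diffusion terms dissipates. -/
theorem setIntegral_diffusion_nonpos {m : ℕ} (l : Fin (m + 1) → ℝ) (hl : ∀ r, 0 < l r)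
    {Ω : Set (EuclideanSpace ℝ (Fin (m + 1)))}
    (hΩ : Ω = {x : EuclideanSpace ℝ (Fin (m + 1)) | ∀ r, |x r| < l r})
    (r : Fin (m + 1)) {ι : Type*} [Fintype ι]
    {u u' u'' : ι → EuclideanSpace ℝ (Fin (m + 1)) → ℝ}
    (hu : ∀ j, ContinuousOn (u j) (closure Ω)) (hu' : ∀ j, ContinuousOn (u' j) (closure Ω))
    (hu'' : ∀ j, ContinuousOn (u'' j) (closure Ω))
    (hu0 : ∀ j, ∀ x ∈ frontier Ω, u j x = 0)
    (hud : ∀ j, ∀ x ∈ Ω,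
      DifferentiableAt ℝ (u j) x ∧ fderiv ℝ (u j) x (EuclideanSpace.single r 1) = u' j x)
    (hud' : ∀ j, ∀ x ∈ Ω,
      DifferentiableAt ℝ (u' j) x ∧ fderiv ℝ (u' j) x (EuclideanSpace.single r 1) = u'' j x)
    (M : ι → ι → ℝ) (hM : ∀ z : ι → ℝ, 0 ≤ ∑ j, ∑ k, M j k * z j * z k) :
    ∫ x in Ω, ∑ j, ∑ k, M j k * (u j x * u'' k x) ≤ 0 := by
  have hK : IsCompact (closure Ω) := hΩ ▸ isCompact_closure_euclidean_box l hl
  have hint : ∀ {f : EuclideanSpace ℝ (Fin (m + 1)) → ℝ}, ContinuousOn f (closure Ω) →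
      IntegrableOn f Ω := fun hf => (hf.integrableOn_compact hK).mono_set subset_closure
  have hsum : ∀ a b : ι → EuclideanSpace ℝ (Fin (m + 1)) → ℝ,
      (∀ j, ContinuousOn (a j) (closure Ω)) → (∀ j, ContinuousOn (b j) (closure Ω)) →
      ∫ x in Ω, ∑ j, ∑ k, M j k * (a j x * b k x)
        = ∑ j, ∑ k, M j k * ∫ x in Ω, a j x * b k x := by
    intro a b ha hb
    have hjk : ∀ j k, IntegrableOn (fun x => M j k * (a j x * b k x)) Ω := fun j k =>
      hint (continuousOn_const.mul ((ha j).mul (hb k)))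
    rw [integral_finsetSum _ fun j _ => integrable_finsetSum _ fun k _ => hjk j k]
    refine Finset.sum_congr rfl fun j _ => ?_
    rw [integral_finsetSum _ fun k _ => hjk j k]
    exact Finset.sum_congr rfl fun k _ => integral_const_mul _ _
  have hparts : ∫ x in Ω, ∑ j, ∑ k, M j k * (u j x * u'' k x)
      = -∫ x in Ω, ∑ j, ∑ k, M j k * (u' j x * u' k x) := by
    rw [hsum u u'' hu hu'', hsum u' u' hu' hu', ← Finset.sum_neg_distrib]
    refine Finset.sum_congr rfl fun j _ => ?_
    rw [← Finset.sum_neg_distrib]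
    refine Finset.sum_congr rfl fun k _ => ?_
    rw [setIntegral_mul_partial_eq_neg l hl hΩ r (hu j) (hu' j) (hu' k) (hu'' k) (hu0 j)
      (hud j) (hud' k), mul_neg]
  rw [hparts, neg_nonpos]
  refine integral_nonneg fun x => ?_
  have := hM fun j => u' j x
  simpa only [Pi.zero_apply, mul_assoc] using this

/-- A parametric integral over a relatively compact set is continuous in the parameter. -/
theorem continuousOn_setIntegral_param {X : Type*} [TopologicalSpace X] [MeasurableSpace X]
    [OpensMeasurableSpace X] [T2Space X] {μ : Measure X} [IsFiniteMeasureOnCompacts μ]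
    {Ω : Set X} (hΩ : MeasurableSet Ω) (hK : IsCompact (closure Ω)) {a : ℝ} {F : ℝ → X → ℝ}
    (hF : ContinuousOn (fun q : ℝ × X => F q.1 q.2) (Ici a ×ˢ closure Ω)) :
    ContinuousOn (fun t => ∫ x in Ω, F t x ∂μ) (Ici a) := by
  intro t₀ ht₀
  obtain ⟨C, hC⟩ := (isCompact_Icc (a := a) (b := t₀ + 1)).prod hK |>.exists_bound_of_continuousOn
    (hF.mono (prod_mono Icc_subset_Ici_self subset_rfl))
  have hint : ∀ t ∈ Ici a, IntegrableOn (F t) Ω μ := fun t ht =>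
    (ContinuousOn.integrableOn_compact hK (hF.comp (f := fun x => (t, x))
      (by fun_prop) fun x hx => ⟨ht, hx⟩)).mono_set subset_closure
  have hfin : IntegrableOn (fun _ : X => C) Ω μ :=
    (integrableOn_const hK.measure_lt_top.ne).mono_set subset_closure
  refine continuousWithinAt_of_dominated (bound := fun _ => C) ?_ ?_ hfin ?_
  · filter_upwards [self_mem_nhdsWithin] with t ht using (hint t ht).aestronglyMeasurable
  · filter_upwards [self_mem_nhdsWithin, mem_nhdsWithin_of_mem_nhds
      (Iio_mem_nhds (lt_add_one t₀))] with t ht ht'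
    filter_upwards [ae_restrict_mem hΩ] with x hx
    exact hC (t, x) ⟨⟨ht, le_of_lt ht'⟩, subset_closure hx⟩
  · filter_upwards [ae_restrict_mem hΩ] with x hx
    exact hF.comp (f := fun t => (t, x)) (by fun_prop) (fun t ht => ⟨ht, subset_closure hx⟩) t₀ ht₀

/-- Differentiation under the integral sign over a relatively compact set. -/
theorem hasDerivAt_setIntegral_param {X : Type*} [TopologicalSpace X] [MeasurableSpace X]
    [OpensMeasurableSpace X] [T2Space X] {μ : Measure X} [IsFiniteMeasureOnCompacts μ]
    {Ω : Set X} (hΩ : MeasurableSet Ω) (hK : IsCompact (closure Ω)) {F F' : ℝ → X → ℝ}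
    (hF : ContinuousOn (fun q : ℝ × X => F q.1 q.2) (Ioi 0 ×ˢ closure Ω))
    (hF' : ContinuousOn (fun q : ℝ × X => F' q.1 q.2) (Ioi 0 ×ˢ closure Ω))
    (hd : ∀ t ∈ Ioi (0 : ℝ), ∀ x ∈ Ω, HasDerivAt (fun s => F s x) (F' t x) t)
    {t : ℝ} (ht : 0 < t) :
    HasDerivAt (fun t => ∫ x in Ω, F t x ∂μ) (∫ x in Ω, F' t x ∂μ) t := by
  have hint : ∀ {f : ℝ → X → ℝ},
      ContinuousOn (fun q : ℝ × X => f q.1 q.2) (Ioi 0 ×ˢ closure Ω) →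
      ∀ s ∈ Ioi (0 : ℝ), IntegrableOn (f s) Ω μ := fun hf s hs =>
    (ContinuousOn.integrableOn_compact hK (hf.comp (f := fun x => (s, x))
      (by fun_prop) fun x hx => ⟨hs, hx⟩)).mono_set subset_closure
  have hsub : Icc (t / 2) (t + 1) ⊆ Ioi (0 : ℝ) := fun s hs => lt_of_lt_of_le (by linarith) hs.1
  obtain ⟨C, hC⟩ := (isCompact_Icc (a := t / 2) (b := t + 1)).prod hK
    |>.exists_bound_of_continuousOn (hF'.mono (prod_mono hsub subset_rfl))
  have hfin : IntegrableOn (fun _ : X => C) Ω μ :=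
    (integrableOn_const hK.measure_lt_top.ne).mono_set subset_closure
  refine (hasDerivAt_integral_of_dominated_loc_of_deriv_le (bound := fun _ => C)
    (Icc_mem_nhds (by linarith : t / 2 < t) (lt_add_one t)) ?_ (hint hF t ht)
    (hint hF' t ht).aestronglyMeasurable ?_ hfin ?_).2
  · filter_upwards [Ioi_mem_nhds ht] with s hs using (hint hF s hs).aestronglyMeasurable
  · filter_upwards [ae_restrict_mem hΩ] with x hx s hs
    exact hC (s, x) ⟨hs, subset_closure hx⟩
  · filter_upwards [ae_restrict_mem hΩ] with x hx s hs
    exact hd s (hsub hs) x hx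

theorem two_mul_bilin_le {κ : Type*} [Fintype κ] (A : Matrix κ κ ℝ) (u v : κ → ℝ) :
    ∑ k, 2 * u k * ∑ q, A k q * v q ≤ (∑ k, ∑ q, |A k q|) * (∑ k, u k ^ 2 + ∑ k, v k ^ 2) := by
  rw [Finset.sum_mul]
  refine Finset.sum_le_sum fun k _ => ?_
  rw [Finset.mul_sum, Finset.sum_mul]
  refine Finset.sum_le_sum fun q _ => ?_
  have h1 : u k ^ 2 ≤ ∑ k, u k ^ 2 :=
    Finset.single_le_sum (f := fun k => u k ^ 2) (fun k _ => sq_nonneg _) (Finset.mem_univ k)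
  have h2 : v q ^ 2 ≤ ∑ k, v k ^ 2 :=
    Finset.single_le_sum (f := fun k => v k ^ 2) (fun k _ => sq_nonneg _) (Finset.mem_univ q)
  calc 2 * u k * (A k q * v q) = A k q * (2 * u k * v q) := by ring
    _ ≤ |A k q * (2 * u k * v q)| := le_abs_self _
    _ = |A k q| * |2 * u k * v q| := abs_mul _ _
    _ ≤ |A k q| * (∑ k, u k ^ 2 + ∑ k, v k ^ 2) := by
      refine mul_le_mul_of_nonneg_left (abs_le.2 ⟨?_, ?_⟩) (abs_nonneg _)
      · nlinarith [sq_nonneg (u k + v q)]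
      · nlinarith [sq_nonneg (u k - v q)]

/-- Pointwise energy estimate: the reaction part is absorbed in quadratic terms, the coupling
yields damping and the diffusion terms are collected in quadratic forms. -/
theorem pointwise_energy_le {ι κ ρ : Type*} [Fintype ι] [DecidableEq ι] [Fintype κ] [Fintype ρ]
    (p : ι → ℝ) (hp : ∀ j, 0 < p j) (D : κ → ρ → ℝ) (c : κ → ℝ) (hc : ∀ k, 0 < c k)
    (A B : Matrix κ κ ℝ) (gs hs φ lam γ : ℝ) (hφ : 0 ≤ φ) (hlam : 0 ≤ lam)
    (L : Matrix ι ι ℝ)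
    (hL : ∀ z : ι → ℝ, ∑ j, ∑ k, p j * L j k * z j * z k ≤ -lam * ∑ j, p j * z j ^ 2)
    (γ1 γ2 : κ → ℝ) (hγ1 : ∀ k, 0 < γ1 k) (hγ : ∀ k, γ ≤ γ1 k)
    (e ed G H de : ι → κ → ℝ) (e2 : ι → κ → ρ → ℝ)
    (hG : ∀ j, ∑ k, G j k ^ 2 ≤ gs ^ 2 * ∑ k, e j k ^ 2)
    (hH : ∀ j, ∑ k, H j k ^ 2 ≤ hs ^ 2 * ∑ k, ed j k ^ 2)
    (hde : ∀ j k, de j k = (∑ r, D k r * e2 j k r) - c k * e j k + (∑ q, A k q * G j q)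
      + (∑ q, B k q * H j q) + φ * (∑ i, L j i * (γ1 k * e i k))
      - φ * (∑ i, L j i * (γ2 k * ∑ r, e2 i k r))) :
    ∑ j, p j * ∑ k, 2 * e j k * de j k ≤
      ((∑ k, ∑ q, |A k q|) * (1 + gs ^ 2) + (∑ k, ∑ q, |B k q|) - 2 * lam * γ * φ)
          * ∑ j, p j * ∑ k, e j k ^ 2
        + (∑ k, ∑ q, |B k q|) * hs ^ 2 * ∑ j, p j * ∑ k, ed j k ^ 2
        + 2 * ∑ k, ∑ r, ∑ j, ∑ i,
          (p j * ((if j = i then D k r else 0) - φ * γ2 k * L j i)) * (e j k * e2 i k r) := by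
  set a₀ := ∑ k, ∑ q, |A k q| with ha₀
  set b₀ := ∑ k, ∑ q, |B k q| with hb₀
  have ha₀0 : 0 ≤ a₀ := Finset.sum_nonneg fun k _ => Finset.sum_nonneg fun q _ => abs_nonneg _
  have hb₀0 : 0 ≤ b₀ := Finset.sum_nonneg fun k _ => Finset.sum_nonneg fun q _ => abs_nonneg _
  have hsplit : ∑ j, p j * ∑ k, 2 * e j k * de j k
      = ∑ j, p j * (∑ k, 2 * e j k * ∑ q, A k q * G j q)
        + ∑ j, p j * (∑ k, 2 * e j k * ∑ q, B k q * H j q)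
        - ∑ j, p j * (∑ k, 2 * e j k * (c k * e j k))
        + 2 * φ * (∑ k, γ1 k * ∑ j, ∑ i, p j * L j i * e j k * e i k)
        + 2 * ∑ k, ∑ r, ∑ j, ∑ i,
          (p j * ((if j = i then D k r else 0) - φ * γ2 k * L j i)) * (e j k * e2 i k r) := by
    have h5 : 2 * φ * (∑ k, γ1 k * ∑ j, ∑ i, p j * L j i * e j k * e i k)
        = ∑ j, p j * ∑ k, 2 * e j k * (φ * (∑ i, L j i * (γ1 k * e i k))) := by
      simp only [Finset.mul_sum]
      rw [Finset.sum_comm]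
      exact Finset.sum_congr rfl fun j _ => Finset.sum_congr rfl fun k _ =>
        Finset.sum_congr rfl fun i _ => by ring
    have h6 : 2 * ∑ k, ∑ r, ∑ j, ∑ i,
          (p j * ((if j = i then D k r else 0) - φ * γ2 k * L j i)) * (e j k * e2 i k r)
        = ∑ j, p j * (∑ k, 2 * e j k * ∑ r, D k r * e2 j k r)
          - ∑ j, p j * ∑ k, 2 * e j k * (φ * (∑ i, L j i * (γ2 k * ∑ r, e2 i k r))) := by
      have h7 : ∀ k r j, ∑ i,
          (p j * ((if j = i then D k r else 0) - φ * γ2 k * L j i)) * (e j k * e2 i k r)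
          = p j * (e j k * (D k r * e2 j k r))
            - ∑ i, p j * (e j k * (φ * (L j i * (γ2 k * e2 i k r)))) := by
        intro k r j
        have h8 : ∀ i, (p j * ((if j = i then D k r else 0) - φ * γ2 k * L j i))
            * (e j k * e2 i k r) = (if j = i then p j * (e j k * (D k r * e2 i k r)) else 0)
              - p j * (e j k * (φ * (L j i * (γ2 k * e2 i k r)))) := by
          intro i; split_ifs <;> ring
        simp only [h8, Finset.sum_sub_distrib, Finset.sum_ite_eq, Finset.mem_univ, if_true]
      simp only [h7, Finset.sum_sub_distrib]
      rw [mul_sub]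
      simp only [Finset.mul_sum]
      congr 1
      · rw [Finset.sum_congr rfl fun k _ => Finset.sum_comm, Finset.sum_comm]
        exact Finset.sum_congr rfl fun j _ => Finset.sum_congr rfl fun k _ =>
          Finset.sum_congr rfl fun r _ => by ring
      · rw [Finset.sum_congr rfl fun k _ => Finset.sum_comm, Finset.sum_comm]
        refine Finset.sum_congr rfl fun j _ => Finset.sum_congr rfl fun k _ => ?_
        rw [Finset.sum_comm]
        exact Finset.sum_congr rfl fun i _ => Finset.sum_congr rfl fun r _ => by ring
    rw [h5, h6]
    simp only [hde, mul_add, mul_sub, Finset.sum_add_distrib, Finset.sum_sub_distrib]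
    ring
  have hA : ∑ j, p j * (∑ k, 2 * e j k * ∑ q, A k q * G j q)
      ≤ a₀ * (1 + gs ^ 2) * ∑ j, p j * ∑ k, e j k ^ 2 := by
    rw [Finset.mul_sum]
    refine Finset.sum_le_sum fun j _ => ?_
    have h1 := two_mul_bilin_le A (e j) (G j)
    have h2 := mul_le_mul_of_nonneg_left (hG j) ha₀0
    calc _ ≤ p j * (a₀ * (1 + gs ^ 2) * ∑ k, e j k ^ 2) :=
          mul_le_mul_of_nonneg_left (by linarith) (hp j).le
      _ = _ := by ring
  have hB : ∑ j, p j * (∑ k, 2 * e j k * ∑ q, B k q * H j q)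
      ≤ b₀ * (∑ j, p j * ∑ k, e j k ^ 2) + b₀ * hs ^ 2 * ∑ j, p j * ∑ k, ed j k ^ 2 := by
    rw [Finset.mul_sum, Finset.mul_sum, ← Finset.sum_add_distrib]
    refine Finset.sum_le_sum fun j _ => ?_
    have h1 := two_mul_bilin_le B (e j) (H j)
    have h2 := mul_le_mul_of_nonneg_left (hH j) hb₀0
    calc _ ≤ p j * (b₀ * (∑ k, e j k ^ 2) + b₀ * hs ^ 2 * ∑ k, ed j k ^ 2) :=
          mul_le_mul_of_nonneg_left (by linarith) (hp j).le
      _ = _ := by ring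
  have hC : 0 ≤ ∑ j, p j * (∑ k, 2 * e j k * (c k * e j k)) :=
    Finset.sum_nonneg fun j _ => mul_nonneg (hp j).le (Finset.sum_nonneg fun k _ => by
      have := hc k
      nlinarith [mul_nonneg this.le (sq_nonneg (e j k))])
  have hcoup : ∑ k, γ1 k * ∑ j, ∑ i, p j * L j i * e j k * e i k
      ≤ -(lam * γ) * ∑ j, p j * ∑ k, e j k ^ 2 := by
    have hswap : ∑ j, p j * ∑ k, e j k ^ 2 = ∑ k, ∑ j, p j * e j k ^ 2 := by
      simp only [Finset.mul_sum]; exact Finset.sum_comm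
    rw [hswap, Finset.mul_sum]
    refine Finset.sum_le_sum fun k _ => ?_
    have h1 := hL fun j => e j k
    have h2 : 0 ≤ ∑ j, p j * e j k ^ 2 :=
      Finset.sum_nonneg fun j _ => mul_nonneg (hp j).le (sq_nonneg _)
    have h3 := mul_le_mul_of_nonneg_left h1 (hγ1 k).le
    have h4 := mul_le_mul_of_nonneg_left (hγ k) (mul_nonneg hlam h2)
    nlinarith
  have hcoup' := mul_le_mul_of_nonneg_left hcoup (by positivity : 0 ≤ 2 * φ)
  rw [hsplit]
  linarith

/-- Energy estimate at a fixed time. -/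
theorem setIntegral_energy_le {m : ℕ} (l : Fin (m + 1) → ℝ) (hl : ∀ r, 0 < l r)
    {Ω : Set (EuclideanSpace ℝ (Fin (m + 1)))}
    (hΩ : Ω = {x : EuclideanSpace ℝ (Fin (m + 1)) | ∀ r, |x r| < l r})
    {ι κ : Type*} [Fintype ι] [Fintype κ]
    (p : ι → ℝ) (hp : ∀ j, 0 < p j) (D : κ → Fin (m + 1) → ℝ) (hD : ∀ k r, 0 ≤ D k r)
    (c : κ → ℝ) (hc : ∀ k, 0 < c k)
    (A B : Matrix κ κ ℝ) (gs hs φ lam γ : ℝ) (hφ : 0 ≤ φ) (hlam : 0 ≤ lam)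
    (L : Matrix ι ι ℝ)
    (hL : ∀ z : ι → ℝ, ∑ j, ∑ k, p j * L j k * z j * z k ≤ -lam * ∑ j, p j * z j ^ 2)
    (γ1 γ2 : κ → ℝ) (hγ1 : ∀ k, 0 < γ1 k) (hγ2 : ∀ k, 0 < γ2 k) (hγ : ∀ k, γ ≤ γ1 k)
    (e ed G H de : ι → κ → EuclideanSpace ℝ (Fin (m + 1)) → ℝ)
    (e1 e2 : ι → κ → Fin (m + 1) → EuclideanSpace ℝ (Fin (m + 1)) → ℝ)
    (hec : ∀ j k, ContinuousOn (e j k) (closure Ω))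
    (hedc : ∀ j k, ContinuousOn (ed j k) (closure Ω))
    (hdec : ∀ j k, ContinuousOn (de j k) (closure Ω))
    (he1c : ∀ j k r, ContinuousOn (e1 j k r) (closure Ω))
    (he2c : ∀ j k r, ContinuousOn (e2 j k r) (closure Ω))
    (he0 : ∀ j k, ∀ x ∈ frontier Ω, e j k x = 0)
    (he1 : ∀ j k r, ∀ x ∈ Ω, DifferentiableAt ℝ (e j k) x ∧
      fderiv ℝ (e j k) x (EuclideanSpace.single r 1) = e1 j k r x)
    (he2 : ∀ j k r, ∀ x ∈ Ω, DifferentiableAt ℝ (e1 j k r) x ∧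
      fderiv ℝ (e1 j k r) x (EuclideanSpace.single r 1) = e2 j k r x)
    (hG : ∀ j, ∀ x ∈ Ω, ∑ k, G j k x ^ 2 ≤ gs ^ 2 * ∑ k, e j k x ^ 2)
    (hH : ∀ j, ∀ x ∈ Ω, ∑ k, H j k x ^ 2 ≤ hs ^ 2 * ∑ k, ed j k x ^ 2)
    (hde : ∀ j k, ∀ x ∈ Ω, de j k x = (∑ r, D k r * e2 j k r x) - c k * e j k x
      + (∑ q, A k q * G j q x) + (∑ q, B k q * H j q x) + φ * (∑ i, L j i * (γ1 k * e i k x))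
      - φ * (∑ i, L j i * (γ2 k * ∑ r, e2 i k r x))) :
    ∫ x in Ω, ∑ j, p j * ∑ k, 2 * e j k x * de j k x ≤
      ((∑ k, ∑ q, |A k q|) * (1 + gs ^ 2) + (∑ k, ∑ q, |B k q|) - 2 * lam * γ * φ)
          * (∫ x in Ω, ∑ j, p j * ∑ k, e j k x ^ 2)
        + (∑ k, ∑ q, |B k q|) * hs ^ 2 * ∫ x in Ω, ∑ j, p j * ∑ k, ed j k x ^ 2 := by
  classical
  have hK : IsCompact (closure Ω) := hΩ ▸ isCompact_closure_euclidean_box l hl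
  have hmeas : MeasurableSet Ω := (hΩ ▸ isOpen_euclidean_box l : IsOpen Ω).measurableSet
  have hint : ∀ {f : EuclideanSpace ℝ (Fin (m + 1)) → ℝ}, ContinuousOn f (closure Ω) →
      IntegrableOn f Ω := fun hf => (hf.integrableOn_compact hK).mono_set subset_closure
  set a := (∑ k, ∑ q, |A k q|) * (1 + gs ^ 2) + (∑ k, ∑ q, |B k q|) - 2 * lam * γ * φ with ha
  set b := (∑ k, ∑ q, |B k q|) * hs ^ 2 with hb
  set M : κ → Fin (m + 1) → ι → ι → ℝ := fun k r j i =>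
    p j * ((if j = i then D k r else 0) - φ * γ2 k * L j i) with hM
  have hc1 : ContinuousOn (fun x => ∑ j, p j * ∑ k, 2 * e j k x * de j k x) (closure Ω) := by
    fun_prop
  have hc2 : ContinuousOn (fun x => ∑ j, p j * ∑ k, e j k x ^ 2) (closure Ω) := by fun_prop
  have hc3 : ContinuousOn (fun x => ∑ j, p j * ∑ k, ed j k x ^ 2) (closure Ω) := by fun_prop
  have hc4 : ∀ k r, ContinuousOn (fun x => ∑ j, ∑ i, M k r j i * (e j k x * e2 i k r x))
      (closure Ω) := fun k r => by fun_prop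
  have hc5 : ContinuousOn (fun x => ∑ k, ∑ r, ∑ j, ∑ i, M k r j i * (e j k x * e2 i k r x))
      (closure Ω) := by fun_prop
  have hdiff : ∫ x in Ω, ∑ k, ∑ r, ∑ j, ∑ i, M k r j i * (e j k x * e2 i k r x) ≤ 0 := by
    rw [integral_finsetSum _ fun k _ => integrable_finsetSum _ fun r _ => hint (hc4 k r)]
    refine Finset.sum_nonpos fun k _ => ?_
    rw [integral_finsetSum _ fun r _ => hint (hc4 k r)]
    refine Finset.sum_nonpos fun r _ => ?_
    refine setIntegral_diffusion_nonpos l hl hΩ r (fun j => hec j k) (fun j => he1c j k r)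
      (fun j => he2c j k r) (fun j => he0 j k) (fun j => he1 j k r) (fun j => he2 j k r)
      (M k r) fun z => ?_
    have h1 : ∑ j, ∑ i, M k r j i * z j * z i
        = D k r * (∑ j, p j * z j ^ 2) - φ * γ2 k * ∑ j, ∑ i, p j * L j i * z j * z i := by
      simp only [Finset.mul_sum, ← Finset.sum_sub_distrib]
      refine Finset.sum_congr rfl fun j _ => ?_
      have h2 : ∀ i, M k r j i * z j * z i = (if j = i then D k r * (p j * z j * z i) else 0)
          - φ * γ2 k * (p j * L j i * z j * z i) := by
        intro i; simp only [hM]; split_ifs <;> ring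
      simp only [h2, Finset.sum_sub_distrib, Finset.sum_ite_eq, Finset.mem_univ, if_true]
      ring
    have h3 : 0 ≤ ∑ j, p j * z j ^ 2 :=
      Finset.sum_nonneg fun j _ => mul_nonneg (hp j).le (sq_nonneg _)
    have h4 : ∑ j, ∑ i, p j * L j i * z j * z i ≤ 0 := (hL z).trans (by nlinarith)
    have h5 := mul_nonneg (hD k r) h3
    have h6 := mul_nonneg (mul_nonneg hφ (hγ2 k).le) (neg_nonneg.2 h4)
    rw [h1]
    linarith
  calc ∫ x in Ω, ∑ j, p j * ∑ k, 2 * e j k x * de j k x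
      ≤ ∫ x in Ω, (a * (∑ j, p j * ∑ k, e j k x ^ 2) + b * (∑ j, p j * ∑ k, ed j k x ^ 2)
        + 2 * ∑ k, ∑ r, ∑ j, ∑ i, M k r j i * (e j k x * e2 i k r x)) := by
        refine setIntegral_mono_on (hint hc1) (hint (((continuousOn_const.mul hc2).add
          (continuousOn_const.mul hc3)).add (continuousOn_const.mul hc5))) hmeas fun x hx => ?_
        exact pointwise_energy_le p hp D c hc A B gs hs φ lam γ hφ hlam L hL γ1 γ2 hγ1 hγ
          (fun j k => e j k x) (fun j k => ed j k x) (fun j k => G j k x) (fun j k => H j k x)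
          (fun j k => de j k x) (fun j k r => e2 j k r x) (fun j => hG j x hx)
          (fun j => hH j x hx) (fun j k => hde j k x hx)
    _ = a * (∫ x in Ω, ∑ j, p j * ∑ k, e j k x ^ 2)
        + b * (∫ x in Ω, ∑ j, p j * ∑ k, ed j k x ^ 2)
        + 2 * ∫ x in Ω, ∑ k, ∑ r, ∑ j, ∑ i, M k r j i * (e j k x * e2 i k r x) := by
        have h1 := (hint hc2).const_mul a
        have h2 := (hint hc3).const_mul b
        have h12 : IntegrableOn (fun x => a * (∑ j, p j * ∑ k, e j k x ^ 2)
          + b * (∑ j, p j * ∑ k, ed j k x ^ 2)) Ω := h1.add h2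
        rw [integral_add h12 ((hint hc5).const_mul 2), integral_add h1 h2,
          integral_const_mul, integral_const_mul, integral_const_mul]
    _ ≤ _ := by linarith

theorem differentiableAt_par {m : ℕ} {u : EuclideanSpace ℝ (Fin m) → ℝ}
    {x : EuclideanSpace ℝ (Fin m)} (hu : ContDiffAt ℝ 2 u x) (r : Fin m) :
    DifferentiableAt ℝ (par u r) x :=
  ((hu.fderiv_right (m := 1) (by norm_num)).differentiableAt (by norm_num)).clm_apply
    (differentiableAt_const _)

theorem par_sub {m : ℕ} {u v : EuclideanSpace ℝ (Fin m) → ℝ} {x : EuclideanSpace ℝ (Fin m)}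
    (hu : DifferentiableAt ℝ u x) (hv : DifferentiableAt ℝ v x) (r : Fin m) :
    par (fun y => u y - v y) r x = par u r x - par v r x := by
  unfold par
  rw [fderiv_fun_sub hu hv]
  rfl

theorem par2_sub {m : ℕ} {u v : EuclideanSpace ℝ (Fin m) → ℝ} {x : EuclideanSpace ℝ (Fin m)}
    (hu : ContDiffAt ℝ 2 u x) (hv : ContDiffAt ℝ 2 v x) (r : Fin m) :
    par2 (fun y => u y - v y) r x = par2 u r x - par2 v r x := by
  have hev : par (fun y => u y - v y) r =ᶠ[nhds x] fun y => par u r y - par v r y := by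
    filter_upwards [hu.eventually (by simp), hv.eventually (by simp)] with y hy hy'
    exact par_sub (hy.differentiableAt (by norm_num)) (hy'.differentiableAt (by norm_num)) r
  unfold par2
  rw [← par_sub (differentiableAt_par hu r) (differentiableAt_par hv r)]
  unfold par at hev ⊢
  rw [hev.fderiv_eq]

theorem lap_sub {m : ℕ} {u v : EuclideanSpace ℝ (Fin m) → ℝ} {x : EuclideanSpace ℝ (Fin m)}
    (hu : ContDiffAt ℝ 2 u x) (hv : ContDiffAt ℝ 2 v x) :
    lap (fun y => u y - v y) x = lap u x - lap v x := by
  simp only [lap, par2_sub hu hv, Finset.sum_sub_distrib]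

theorem drift_sub {m n : ℕ} (D : Fin n → Fin m → ℝ) (c : Fin n → ℝ)
    (A B : Matrix (Fin n) (Fin n) ℝ) (η : Fin n → ℝ) (g h : (Fin n → ℝ) → Fin n → ℝ)
    (τ : ℝ → ℝ) (w v : ℝ → EuclideanSpace ℝ (Fin m) → Fin n → ℝ)
    (t : ℝ) (x : EuclideanSpace ℝ (Fin m)) (k : Fin n) :
    drift D c A B η g h τ w t x k - drift D c A B η g h τ v t x k =
      (∑ r, D k r * (par2 (fun y => w t y k) r x - par2 (fun y => v t y k) r x))
        - c k * (w t x k - v t x k) + (∑ q, A k q * (g (w t x) q - g (v t x) q))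
        + (∑ q, B k q * (h (w (t - τ t) x) q - h (v (t - τ t) x) q)) := by
  simp only [drift, mul_sub, Finset.sum_sub_distrib]
  ring

/-- A coupling with zero row sums sees only the differences to a common reference value. -/
theorem sum_coupling_sub {ι : Type*} [Fintype ι] {a : ι → ℝ} (ha : ∑ i, a i = 0)
    (γ : ℝ) (f : ι → ℝ) (v : ℝ) : ∑ i, a i * (γ * (f i - v)) = ∑ i, a i * (γ * f i) := by
  have h : ∀ i, a i * (γ * (f i - v)) = a i * (γ * f i) - a i * (γ * v) := fun i => by ring
  simp only [h, Finset.sum_sub_distrib, ← Finset.sum_mul, ha, zero_mul, sub_zero]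

theorem sum_sq_sub_le_of_sqrt_le {κ : Type*} [Fintype κ] {f : (κ → ℝ) → κ → ℝ} {K : ℝ}
    (hf : ∀ u v, Real.sqrt (∑ k, (f u k - f v k) ^ 2) ≤ K * Real.sqrt (∑ k, (u k - v k) ^ 2))
    (u v : κ → ℝ) : ∑ k, (f u k - f v k) ^ 2 ≤ K ^ 2 * ∑ k, (u k - v k) ^ 2 := by
  have h := pow_le_pow_left₀ (Real.sqrt_nonneg _) (hf u v) 2
  rwa [mul_pow, Real.sq_sqrt (Finset.sum_nonneg fun _ _ => sq_nonneg _),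
    Real.sq_sqrt (Finset.sum_nonneg fun _ _ => sq_nonneg _)] at h

/-- Theorem 2: asymptotic complete synchronization of the
hybrid-coupled reaction-diffusion neural network with time-varying delays and
an adaptive coupling strength `Ψ` under aperiodically intermittent pinning
control of node `1` (index `0`), when the delay bound `τ̄` is smaller than the
infimum `θ` of the control span widths. -/
theorem adaptive_hybrid_network_synchronization (m n N : ℕ)
    (l : Fin (m + 1) → ℝ) (hl : ∀ r, 0 < l r)
    (Ω : Set (EuclideanSpace ℝ (Fin (m + 1))))
    (hΩ : Ω = {x : EuclideanSpace ℝ (Fin (m + 1)) | ∀ r, |x r| < l r})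
    (D : Fin (n + 1) → Fin (m + 1) → ℝ) (hD : ∀ k r, 0 ≤ D k r)
    (c : Fin (n + 1) → ℝ) (hc : ∀ k, 0 < c k)
    (A B : Matrix (Fin (n + 1)) (Fin (n + 1)) ℝ) (η : Fin (n + 1) → ℝ)
    (τb : ℝ) (hτb : 0 < τb)
    (τ : ℝ → ℝ) (hτ : ∀ t, τ t ∈ Icc 0 τb)
    (g h : (Fin (n + 1) → ℝ) → Fin (n + 1) → ℝ)
    (gs hs : ℝ) (hgs : 0 < gs) (hhs : 0 < hs)
    (hLipg : ∀ u v, Real.sqrt (∑ k, (g u k - g v k) ^ 2) ≤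
      gs * Real.sqrt (∑ k, (u k - v k) ^ 2))
    (hLiph : ∀ u v, Real.sqrt (∑ k, (h u k - h v k) ^ 2) ≤
      hs * Real.sqrt (∑ k, (u k - v k) ^ 2))
    (Ξ : Matrix (Fin (N + 1)) (Fin (N + 1)) ℝ)
    (hΞoff : ∀ j k, j ≠ k → 0 ≤ Ξ j k)
    (hΞrow : ∀ j, ∑ k, Ξ j k = 0)
    (hΞirr : ∀ S : Finset (Fin (N + 1)), S.Nonempty → S ≠ Finset.univ →
      ∃ j ∈ S, ∃ k, k ∉ S ∧ 0 < Ξ j k)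
    (σ : ℝ) (hσ : 0 < σ)
    (γ1 γ2 : Fin (n + 1) → ℝ) (hγ1 : ∀ k, 0 < γ1 k) (hγ2 : ∀ k, 0 < γ2 k)
    (ts ss : ℕ → ℝ) (hts0 : ts 0 = 0)
    (hcs : ∀ i, ts i < ss i) (hrs : ∀ i, ss i < ts (i + 1))
    (htlim : Tendsto ts atTop atTop)
    (θ ω : ℝ) (hθ : 0 < θ) (hθω : θ < ω)
    (hinf : (⨅ i, (ss i - ts i)) = θ) (hsup : (⨆ i, (ts (i + 1) - ts i)) = ω)
    (hτθ : τb < θ)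
    (π : ℝ → EuclideanSpace ℝ (Fin (m + 1)) → Fin (n + 1) → ℝ)
    (w : Fin (N + 1) → ℝ → EuclideanSpace ℝ (Fin (m + 1)) → Fin (n + 1) → ℝ)
    -- regularity of the target trajectory and of the node states
    (hπC : ContinuousOn (fun q : ℝ × EuclideanSpace ℝ (Fin (m + 1)) => π q.1 q.2)
      (Ici (-τb) ×ˢ closure Ω))
    (hwC : ∀ j, ContinuousOn
      (fun q : ℝ × EuclideanSpace ℝ (Fin (m + 1)) => w j q.1 q.2)
      (Ici (-τb) ×ˢ closure Ω))
    (hπbd : ∀ t ∈ Ici (-τb), ∀ x ∈ frontier Ω, π t x = 0)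
    (hwbd : ∀ j, ∀ t ∈ Ici (-τb), ∀ x ∈ frontier Ω, w j t x = 0)
    (hπx : ∀ t ∈ Ici (-τb), ContDiffOn ℝ 2 (π t) (closure Ω))
    (hwx : ∀ j, ∀ t ∈ Ici (-τb), ContDiffOn ℝ 2 (w j t) (closure Ω))
    (hπx1 : ∀ (k : Fin (n + 1)) (r : Fin (m + 1)), ContinuousOn
      (fun q : ℝ × EuclideanSpace ℝ (Fin (m + 1)) => par (fun y => π q.1 y k) r q.2)
      (Ici (-τb) ×ˢ closure Ω))
    (hπx2 : ∀ (k : Fin (n + 1)) (r : Fin (m + 1)), ContinuousOn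
      (fun q : ℝ × EuclideanSpace ℝ (Fin (m + 1)) => par2 (fun y => π q.1 y k) r q.2)
      (Ici (-τb) ×ˢ closure Ω))
    (hwx1 : ∀ j (k : Fin (n + 1)) (r : Fin (m + 1)), ContinuousOn
      (fun q : ℝ × EuclideanSpace ℝ (Fin (m + 1)) => par (fun y => w j q.1 y k) r q.2)
      (Ici (-τb) ×ˢ closure Ω))
    (hwx2 : ∀ j (k : Fin (n + 1)) (r : Fin (m + 1)), ContinuousOn
      (fun q : ℝ × EuclideanSpace ℝ (Fin (m + 1)) => par2 (fun y => w j q.1 y k) r q.2)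
      (Ici (-τb) ×ˢ closure Ω))
    -- jointly continuous time derivatives on (0,∞)
    (hwt : ∀ j, ∃ w' : ℝ → EuclideanSpace ℝ (Fin (m + 1)) → Fin (n + 1) → ℝ,
      ContinuousOn (fun q : ℝ × EuclideanSpace ℝ (Fin (m + 1)) => w' q.1 q.2)
        (Ioi 0 ×ˢ closure Ω) ∧
      ∀ t ∈ Ioi (0 : ℝ), ∀ x ∈ closure Ω,
        HasDerivAt (fun s => w j s x) (w' t x) t)
    (hπt : ∃ π' : ℝ → EuclideanSpace ℝ (Fin (m + 1)) → Fin (n + 1) → ℝ,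
      ContinuousOn (fun q : ℝ × EuclideanSpace ℝ (Fin (m + 1)) => π' q.1 q.2)
        (Ioi 0 ×ˢ closure Ω) ∧
      ∀ t ∈ Ioi (0 : ℝ), ∀ x ∈ closure Ω,
        HasDerivAt (fun s => π s x) (π' t x) t)
    -- the adaptive aperiodically intermittent coupling strength
    (ψ : ℝ) (hψ : 0 < ψ)
    (Ψ : ℝ → ℝ) (hΨnn : ∀ t ≥ (0 : ℝ), 0 ≤ Ψ t) (hΨ0 : Ψ 0 = 0)
    (hΨrest : ∀ i, ∀ t ∈ Ioo (ss i) (ts (i + 1)), Ψ t = 0)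
    (hΨjump : ∀ i, Ψ (ts (i + 1)) = Ψ (ss i))
    (hΨd : ∀ i, ∀ t ∈ Icc (ts i) (ss i),
      HasDerivWithinAt Ψ
        (ψ * sSup ((fun ς => ∑ j, ∫ x in Ω,
          ∑ k, (w j (t + ς) x k - π (t + ς) x k) ^ 2) '' Icc (-τb) 0))
        (Icc (ts i) (ss i)) t)
    -- the target trajectory
    (hπeq : ∀ t > (0 : ℝ), ∀ x ∈ Ω,
      HasDerivAt (fun s => π s x) (drift D c A B η g h τ π t x) t)
    -- node `0` during the control spans (adaptively pinned)
    (hw0ctrl : ∀ i, ∀ t ∈ Icc (ts i) (ss i), 0 < t → ∀ x ∈ Ω,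
      HasDerivAt (fun s => w 0 s x)
        (fun k => drift D c A B η g h τ (w 0) t x k
          + Ψ t * (∑ k', Ξ 0 k' * (γ1 k * w k' t x k))
          - Ψ t * (∑ k', Ξ 0 k' * (γ2 k * lap (fun y => w k' t y k) x))
          + Ψ t * σ * (γ1 k * (π t x k - w 0 t x k))
          - Ψ t * σ * (γ2 k * lap (fun y => π t y k - w 0 t y k) x)) t)
    -- nodes `j ≠ 0` during the control spans (adaptive coupling)
    (hwctrl : ∀ j, j ≠ 0 → ∀ i, ∀ t ∈ Icc (ts i) (ss i), 0 < t → ∀ x ∈ Ω,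
      HasDerivAt (fun s => w j s x)
        (fun k => drift D c A B η g h τ (w j) t x k
          + Ψ t * (∑ k', Ξ j k' * (γ1 k * w k' t x k))
          - Ψ t * (∑ k', Ξ j k' * (γ2 k * lap (fun y => w k' t y k) x))) t)
    -- all nodes during the rest spans (coupling strength 1)
    (hwrest : ∀ j, ∀ i, ∀ t ∈ Ioo (ss i) (ts (i + 1)), ∀ x ∈ Ω,
      HasDerivAt (fun s => w j s x)
        (fun k => drift D c A B η g h τ (w j) t x k
          + (∑ k', Ξ j k' * (γ1 k * w k' t x k))
          - (∑ k', Ξ j k' * (γ2 k * lap (fun y => w k' t y k) x))) t) :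
    Tendsto (fun t => Real.sqrt (∑ j, ∫ x in Ω, ∑ k, (w j t x k - π t x k) ^ 2))
      atTop (nhds 0) := by
  have hΩo : IsOpen Ω := hΩ ▸ isOpen_euclidean_box l
  have hΩK : IsCompact (closure Ω) := hΩ ▸ isCompact_closure_euclidean_box l hl
  have hΩm : MeasurableSet Ω := hΩo.measurableSet
  obtain ⟨p, hp, hpΞ⟩ := exists_pos_left_null Ξ hΞoff hΞrow hΞirr
  obtain ⟨κ, hκ, hκΞ⟩ := exists_pinned_coupling_form_le Ξ hΞoff hΞrow hΞirr p hp hpΞ 0 σ hσ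
  obtain ⟨k₀, hk₀⟩ := Finite.exists_min γ1
  choose w' hw'c hw'd using hwt
  obtain ⟨π', hπ'c, hπ'd⟩ := hπt
  have hemb : ∀ {a : ℝ} {t : ℝ}, t ∈ Ici a → ∀ {f : ℝ × EuclideanSpace ℝ (Fin (m + 1)) → ℝ},
      ContinuousOn f (Ici a ×ˢ closure Ω) → ContinuousOn (fun x => f (t, x)) (closure Ω) :=
    fun ht f hf => hf.comp (by fun_prop) fun x hx => ⟨ht, hx⟩
  have heC : ∀ j k, ContinuousOn (fun q : ℝ × EuclideanSpace ℝ (Fin (m + 1)) =>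
      w j q.1 q.2 k - π q.1 q.2 k) (Ici (-τb) ×ˢ closure Ω) := fun j k =>
    (continuousOn_pi.1 (hwC j) k).sub (continuousOn_pi.1 hπC k)
  have hdeC : ∀ j k, ContinuousOn (fun q : ℝ × EuclideanSpace ℝ (Fin (m + 1)) =>
      w' j q.1 q.2 k - π' q.1 q.2 k) (Ioi 0 ×ˢ closure Ω) := fun j k =>
    (continuousOn_pi.1 (hw'c j) k).sub (continuousOn_pi.1 hπ'c k)
  have hwxk : ∀ j k, ∀ t ∈ Ici (-τb), ∀ x ∈ Ω, ContDiffAt ℝ 2 (fun y => w j t y k) x :=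
    fun j k t ht x hx => contDiffAt_pi.1 ((hwx j t ht).contDiffAt
      (mem_of_superset (hΩo.mem_nhds hx) subset_closure)) k
  have hπxk : ∀ k, ∀ t ∈ Ici (-τb), ∀ x ∈ Ω, ContDiffAt ℝ 2 (fun y => π t y k) x :=
    fun k t ht x hx => contDiffAt_pi.1 ((hπx t ht).contDiffAt
      (mem_of_superset (hΩo.mem_nhds hx) subset_closure)) k
  set V : ℝ → ℝ := fun t => ∫ x in Ω, ∑ j, p j * ∑ k, (w j t x k - π t x k) ^ 2 with hV
  set V' : ℝ → ℝ := fun t => ∫ x in Ω, ∑ j, p j * ∑ k,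
    2 * (w j t x k - π t x k) * (w' j t x k - π' t x k) with hV'
  set E : ℝ → ℝ := fun t => ∑ j, ∫ x in Ω, ∑ k, (w j t x k - π t x k) ^ 2 with hE
  have hVc : ContinuousOn V (Ici (-τb)) := by
    refine continuousOn_setIntegral_param hΩm hΩK ?_
    exact continuousOn_finsetSum _ fun j _ => continuousOn_const.mul
      (continuousOn_finsetSum _ fun k _ => (heC j k).pow 2)
  have hEc : ContinuousOn E (Ici (-τb)) := by
    refine continuousOn_finsetSum _ fun j _ => continuousOn_setIntegral_param hΩm hΩK ?_
    exact continuousOn_finsetSum _ fun k _ => (heC j k).pow 2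
  have hVd : ∀ t > 0, HasDerivAt V (V' t) t := by
    intro t ht
    have hsub : Ioi (0 : ℝ) ×ˢ closure Ω ⊆ Ici (-τb) ×ˢ closure Ω :=
      prod_mono (fun s hs => by simp only [mem_Ioi, mem_Ici] at *; linarith) le_rfl
    refine hasDerivAt_setIntegral_param (μ := volume)
      (F := fun t x => ∑ j, p j * ∑ k, (w j t x k - π t x k) ^ 2)
      (F' := fun t x => ∑ j, p j * ∑ k, 2 * (w j t x k - π t x k) * (w' j t x k - π' t x k))
      hΩm hΩK ?_ ?_ (fun s hs x hx => ?_) ht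
    · exact continuousOn_finsetSum _ fun j _ => continuousOn_const.mul
        (continuousOn_finsetSum _ fun k _ => ((heC j k).mono hsub).pow 2)
    · exact continuousOn_finsetSum _ fun j _ => continuousOn_const.mul
        (continuousOn_finsetSum _ fun k _ =>
          (continuousOn_const.mul ((heC j k).mono hsub)).mul (hdeC j k))
    · refine HasDerivAt.fun_sum fun j _ => HasDerivAt.const_mul _ (HasDerivAt.fun_sum fun k _ => ?_)
      have h1 := ((hasDerivAt_pi.1 (hw'd j s hs x (subset_closure hx)) k).fun_sub
        (hasDerivAt_pi.1 (hπ'd s hs x (subset_closure hx)) k)).fun_pow 2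
      simpa using h1
  have hint : ∀ t ∈ Ici (-τb), ∀ j,
      IntegrableOn (fun x => ∑ k, (w j t x k - π t x k) ^ 2) Ω := fun t ht j =>
    (ContinuousOn.integrableOn_compact hΩK (continuousOn_finsetSum _ fun k _ =>
      (hemb ht (heC j k)).pow 2)).mono_set subset_closure
  have hI0 : ∀ t j, 0 ≤ ∫ x in Ω, ∑ k, (w j t x k - π t x k) ^ 2 := fun t j =>
    integral_nonneg fun x => Finset.sum_nonneg fun k _ => sq_nonneg _
  have hVsum : ∀ t ∈ Ici (-τb), V t = ∑ j, p j * ∫ x in Ω, ∑ k, (w j t x k - π t x k) ^ 2 := by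
    intro t ht
    simp only [hV]
    rw [integral_finsetSum _ fun j _ => (hint t ht j).const_mul (p j)]
    simp only [integral_const_mul]
  have hV0 : ∀ t, 0 ≤ V t := fun t => integral_nonneg fun x => Finset.sum_nonneg fun j _ =>
    mul_nonneg (hp j).le (Finset.sum_nonneg fun k _ => sq_nonneg _)
  have hE0 : ∀ t, 0 ≤ E t := fun t => Finset.sum_nonneg fun j _ => hI0 t j
  have henergy : ∀ t > 0, ∀ (φ lam : ℝ) (L : Matrix (Fin (N + 1)) (Fin (N + 1)) ℝ), 0 ≤ φ →
      0 ≤ lam → (∀ z : Fin (N + 1) → ℝ,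
        ∑ j, ∑ k, p j * L j k * z j * z k ≤ -lam * ∑ j, p j * z j ^ 2) →
      (∀ j k, ∀ x ∈ Ω, w' j t x k - π' t x k =
        (drift D c A B η g h τ (w j) t x k - drift D c A B η g h τ π t x k)
        + φ * (∑ i, L j i * (γ1 k * (w i t x k - π t x k)))
        - φ * (∑ i, L j i * (γ2 k * (lap (fun y => w i t y k) x - lap (fun y => π t y k) x)))) →
      V' t ≤ ((∑ k, ∑ q, |A k q|) * (1 + gs ^ 2) + (∑ k, ∑ q, |B k q|)
        - 2 * lam * γ1 k₀ * φ) * V t + (∑ k, ∑ q, |B k q|) * hs ^ 2 * V (t - τ t) := by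
    intro t ht φ lam L hφ hlam hL hde
    have ht' : t ∈ Ici (-τb) := by simp only [mem_Ici]; linarith
    have htd : t - τ t ∈ Ici (-τb) := by simp only [mem_Ici]; linarith [(hτ t).2]
    refine setIntegral_energy_le l hl hΩ p hp D hD c hc A B gs hs φ lam (γ1 k₀) hφ hlam L hL
      γ1 γ2 hγ1 hγ2 hk₀ (fun j k x => w j t x k - π t x k)
      (fun j k x => w j (t - τ t) x k - π (t - τ t) x k)
      (fun j k x => g (w j t x) k - g (π t x) k)
      (fun j k x => h (w j (t - τ t) x) k - h (π (t - τ t) x) k)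
      (fun j k x => w' j t x k - π' t x k)
      (fun j k r x => par (fun y => w j t y k) r x - par (fun y => π t y k) r x)
      (fun j k r x => par2 (fun y => w j t y k) r x - par2 (fun y => π t y k) r x)
      (fun j k => hemb ht' (heC j k)) (fun j k => hemb htd (heC j k))
      (fun j k => (hdeC j k).comp (f := fun x => (t, x)) (by fun_prop) fun x hx => ⟨ht, hx⟩)
      (fun j k r => hemb ht' ((hwx1 j k r).sub (hπx1 k r)))
      (fun j k r => hemb ht' ((hwx2 j k r).sub (hπx2 k r)))
      (fun j k x hx => by simp [hwbd j t ht' x hx, hπbd t ht' x hx])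
      (fun j k r x hx => ?_) (fun j k r x hx => ?_)
      (fun j x _ => sum_sq_sub_le_of_sqrt_le hLipg _ _)
      (fun j x _ => sum_sq_sub_le_of_sqrt_le hLiph _ _) (fun j k x hx => ?_)
    · have h1 := (hwxk j k t ht' x hx).differentiableAt (by norm_num)
      have h2 := (hπxk k t ht' x hx).differentiableAt (by norm_num)
      exact ⟨h1.fun_sub h2, par_sub h1 h2 r⟩
    · have h1 := differentiableAt_par (hwxk j k t ht' x hx) r
      have h2 := differentiableAt_par (hπxk k t ht' x hx) r
      exact ⟨h1.fun_sub h2, par_sub h1 h2 r⟩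
    · simp only [hde j k x hx, drift_sub, lap, Finset.sum_sub_distrib]
  have hπ'eq : ∀ t > 0, ∀ x ∈ Ω, ∀ k, π' t x k = drift D c A B η g h τ π t x k :=
    fun t ht x hx k => congrFun
      ((hπ'd t ht x (subset_closure hx)).unique (hπeq t ht x hx)) k
  set a₀ := ∑ k, ∑ q, |A k q| with ha₀
  set b₀ := ∑ k, ∑ q, |B k q| with hb₀
  have ha₀0 : 0 ≤ a₀ := Finset.sum_nonneg fun k _ => Finset.sum_nonneg fun q _ => abs_nonneg _
  have hb₀0 : 0 ≤ b₀ := Finset.sum_nonneg fun k _ => Finset.sum_nonneg fun q _ => abs_nonneg _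
  have hctrl : ∀ i, ∀ t ∈ Icc (ts i) (ss i), 0 < t →
      V' t ≤ (a₀ * (1 + gs ^ 2) + b₀ - 2 * κ * γ1 k₀ * Ψ t) * V t
        + b₀ * hs ^ 2 * V (t - τ t) := by
    intro i t hti ht
    have ht' : t ∈ Ici (-τb) := by simp only [mem_Ici]; linarith
    have hsum : ∀ (j : Fin (N + 1)) (f : Fin (N + 1) → ℝ),
        ∑ i, (Ξ j i - if j = 0 ∧ i = 0 then σ else 0) * f i
          = (∑ i, Ξ j i * f i) - if j = 0 then σ * f 0 else 0 := by
      intro j f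
      by_cases hj : j = 0 <;> simp [hj, sub_mul, Finset.sum_sub_distrib]
    refine henergy t ht (Ψ t) κ (fun j i => Ξ j i - if j = 0 ∧ i = 0 then σ else 0)
      (hΨnn t ht.le) hκ.le (fun z => ?_) (fun j k x hx => ?_)
    · refine le_of_eq_of_le ?_ (hκΞ z)
      have h1 : ∀ j, ∑ k, p j * (Ξ j k - if j = 0 ∧ k = 0 then σ else 0) * z j * z k
          = (∑ k, p j * Ξ j k * z j * z k) - if j = 0 then p 0 * σ * z 0 ^ 2 else 0 := by
        intro j
        have h2 : ∀ k, p j * (Ξ j k - if j = 0 ∧ k = 0 then σ else 0) * z j * z k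
          = p j * z j * ((Ξ j k - if j = 0 ∧ k = 0 then σ else 0) * z k) := fun k => by ring
        rw [Finset.sum_congr rfl fun k _ => h2 k, ← Finset.mul_sum, hsum, mul_sub, Finset.mul_sum]
        congr 1
        · exact Finset.sum_congr rfl fun k _ => by ring
        · by_cases hj : j = 0
          · simp only [hj, if_true]; ring
          · simp [hj]
      simp only [h1, Finset.sum_sub_distrib, Finset.sum_ite_eq', Finset.mem_univ, if_true]
    · rw [hπ'eq t ht x hx k, hsum, hsum, sum_coupling_sub (hΞrow j), sum_coupling_sub (hΞrow j)]
      by_cases hj : j = 0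
      · subst hj
        rw [congrFun ((hw'd 0 t ht x (subset_closure hx)).unique (hw0ctrl i t hti ht x hx)) k,
          lap_sub (hπxk k t ht' x hx) (hwxk 0 k t ht' x hx)]
        simp only [if_true]
        ring
      · rw [congrFun ((hw'd j t ht x (subset_closure hx)).unique
          (hwctrl j hj i t hti ht x hx)) k]
        simp only [hj, if_false]
        ring
  have hrest : ∀ i, ∀ t ∈ Ioo (ss i) (ts (i + 1)), 0 < t →
      V' t ≤ (a₀ * (1 + gs ^ 2) + b₀) * V t + b₀ * hs ^ 2 * V (t - τ t) := by
    intro i t hti ht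
    have h1 := henergy t ht 1 0 Ξ zero_le_one le_rfl
      (fun z => by simpa using coupling_form_nonpos Ξ hΞoff hΞrow p hp hpΞ z)
      (fun j k x hx => by
        rw [hπ'eq t ht x hx k, sum_coupling_sub (hΞrow j), sum_coupling_sub (hΞrow j),
          congrFun ((hw'd j t ht x (subset_closure hx)).unique (hwrest j i t hti x hx)) k]
        ring)
    simpa using h1
  have hle : ∀ t > 0, V' t ≤ (a₀ * (1 + gs ^ 2) + b₀) * V t + b₀ * hs ^ 2 * V (t - τ t) := by
    intro t ht
    obtain ⟨i, -, hi⟩ := exists_mem_Ico_of_tendsto_atTop htlim 0 (hts0.trans_le ht.le)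
    rcases le_or_gt t (ss i) with hle | hlt
    · have h1 := hctrl i t ⟨hi.1, hle⟩ ht
      have h2 : 0 ≤ 2 * κ * γ1 k₀ * Ψ t * V t := mul_nonneg (mul_nonneg
        (mul_nonneg (by positivity) (hγ1 k₀).le) (hΨnn t ht.le)) (hV0 t)
      linarith
    · exact hrest i t ⟨hlt, hi.2⟩ ht
  have hθle : ∀ i, θ ≤ ss i - ts i := fun i => hinf ▸ ciInf_le
    ⟨0, by rintro _ ⟨j, rfl⟩; exact (sub_pos.2 (hcs j)).le⟩ i
  have hbdd : BddAbove (range fun i => ts (i + 1) - ts i) := by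
    by_contra hnb
    have := Real.iSup_of_not_bddAbove hnb
    linarith
  have hleω : ∀ i, ts (i + 1) - ts i ≤ ω := fun i => hsup ▸ le_ciSup hbdd i
  have hpP : ∀ j, p j ≤ ∑ j, p j := fun j =>
    Finset.single_le_sum (fun j _ => (hp j).le) (Finset.mem_univ j)
  have hVE : ∀ t ∈ Ici (-τb), V t ≤ (∑ j, p j) * E t := by
    intro t ht
    rw [hVsum t ht, hE, Finset.mul_sum]
    exact Finset.sum_le_sum fun j _ => mul_le_mul_of_nonneg_right (hpP j) (hI0 t j)
  have hEV : ∀ t ∈ Ici (-τb), E t ≤ (∑ j, (p j)⁻¹) * V t := by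
    intro t ht
    rw [Finset.sum_mul]
    refine Finset.sum_le_sum fun j _ => ?_
    rw [inv_mul_eq_div, le_div_iff₀' (hp j), hVsum t ht]
    exact Finset.single_le_sum (f := fun j => p j * ∫ x in Ω, ∑ k, (w j t x k - π t x k) ^ 2)
      (fun j _ => mul_nonneg (hp j).le (hI0 t j)) (Finset.mem_univ j)
  have hVlim : Tendsto V atTop (nhds 0) :=
    tendsto_zero_of_adaptive_delay_inequality (β := 2 * κ * γ1 k₀)
      (add_nonneg (mul_nonneg ha₀0 (by positivity)) hb₀0) (mul_nonneg hb₀0 (sq_nonneg hs))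
      (mul_pos (mul_pos two_pos hκ) (hγ1 k₀)) hψ (Finset.sum_nonneg fun j _ => (hp j).le)
      hτ hτθ hts0 hθle hrs hleω htlim hV0 hVc hVd hle hctrl hE0 hEc hVE hΨjump hΨd
  have hElim : Tendsto E atTop (nhds 0) := by
    refine tendsto_of_tendsto_of_tendsto_of_le_of_le' tendsto_const_nhds
      (by simpa using hVlim.const_mul (∑ j, (p j)⁻¹)) (Eventually.of_forall hE0) ?_
    filter_upwards [eventually_ge_atTop (-τb)] with t ht using hEV t ht
  simpa using hElim.sqrt
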